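/- For every N ≥ 2, θ ∈ (0, π/2], ã > 0, d > 0 and m > 0 there exists a constant C > 0, depending only on N, θ, ã, d and m, such that the following holds: for every bounded domain Ω ⊂ ℝ^N with diameter at most d satisfying the (θ,ã)-uniform interior cone condition and every torsion function u on Ω which is C¹ up to the boundary with |∇u(x)| ≥ m for all x ∈ ∂Ω, the function h(x) := |x−z|²/2 − u(x), with z the barycenter of Ω, satisfies ∫_{∂Ω} (h − h_Ω)² dH^{N−1} ≤ C ∫_Ω (−u) |∇h|² dx, where h_Ω := (1/|Ω|)∫_Ω h dx. -/

import Mathlib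

open MeasureTheory Metric Set Real RealInnerProductSpace

noncomputable section

/-- Euclidean space `ℝ^N`. -/
abbrev Euc (N : ℕ) : Type := EuclideanSpace ℝ (Fin N)

/-- The `(i,j)` entry of the Hessian matrix of `u` at `x`. -/
def hessEntry {N : ℕ} (u : Euc N → ℝ) (x : Euc N) (i j : Fin N) : ℝ :=
  fderiv ℝ (fun y => fderiv ℝ u y (EuclideanSpace.single j (1 : ℝ))) x
    (EuclideanSpace.single i (1 : ℝ))

/-- Squared Frobenius norm of the Hessian of `u` at `x`. -/
def hessNormSq {N : ℕ} (u : Euc N → ℝ) (x : Euc N) : ℝ :=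
  ∑ i, ∑ j, (hessEntry u x i j) ^ 2

/-- The Laplacian of `u` at `x` (trace of the Hessian). -/
def lap {N : ℕ} (u : Euc N → ℝ) (x : Euc N) : ℝ := ∑ i, hessEntry u x i i

/-- `u` is a torsion function on `Ω`: continuous on the closure, `C²` inside,
`Δu = N` in `Ω` and `u = 0` on `∂Ω`. -/
def IsTorsion {N : ℕ} (Ω : Set (Euc N)) (u : Euc N → ℝ) : Prop :=
  ContinuousOn u (closure Ω) ∧ ContDiffOn ℝ 2 u Ω ∧
    (∀ x ∈ Ω, lap u x = N) ∧ ∀ x ∈ frontier Ω, u x = 0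

/-- `G` is a `b₀`-John domain. -/
def IsJohn {N : ℕ} (b₀ : ℝ) (G : Set (Euc N)) : Prop :=
  ∀ a ∈ G, ∀ b ∈ G, a ≠ b → ∃ γ : ℝ → Euc N,
    ContinuousOn γ (Icc 0 1) ∧ γ 0 = a ∧ γ 1 = b ∧ (∀ t ∈ Icc (0:ℝ) 1, γ t ∈ G) ∧
    ∀ t ∈ Icc (0:ℝ) 1, b₀⁻¹ * min (dist (γ t) a) (dist (γ t) b) ≤ infDist (γ t) (frontier G)

/-- `(θ, a)`-uniform interior cone condition. -/
def UnifConeCond {N : ℕ} (θ a : ℝ) (G : Set (Euc N)) : Prop :=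
  ∀ x ∈ frontier G, ∃ ω : Euc N, ‖ω‖ = 1 ∧
    ∀ w ∈ ball x a ∩ closure G, ∀ y : Euc N,
      ⟪y, ω⟫ > ‖y‖ * Real.cos θ → ‖y‖ < a → w + y ∈ G

/-- `r`-uniform interior sphere condition. -/
def IntSphere {N : ℕ} (r : ℝ) (Ω : Set (Euc N)) : Prop :=
  ∀ x ∈ frontier Ω, ∃ c : Euc N, ball c r ⊆ Ω ∧ dist x c = r

/-- `r`-uniform exterior sphere condition. -/
def ExtSphere {N : ℕ} (r : ℝ) (Ω : Set (Euc N)) : Prop :=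
  ∀ x ∈ frontier Ω, ∃ c : Euc N, ball c r ⊆ (closure Ω)ᶜ ∧ dist x c = r

section Calculus

open Filter Topology

variable {N : ℕ} {Ω : Set (Euc N)} {u : Euc N → ℝ} {x z : Euc N} {c₁ c₂ c₃ : ℝ}

lemma hasFDerivAt_half_norm_sub_sq (x z : Euc N) :
    HasFDerivAt (fun y : Euc N => ‖y - z‖ ^ 2 / 2) (innerSL ℝ (x - z)) x := by
  have h := ((hasFDerivAt_id (𝕜 := ℝ) x).sub_const z).norm_sq.mul_const (1 / 2)
  have h' := h.congr_fderiv (g' := innerSL ℝ (x - z)) (by ext y; simp)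
  simpa [div_eq_mul_inv] using h'

lemma hasFDerivAt_quadratic_comb (hu : DifferentiableAt ℝ u x) :
    HasFDerivAt (fun y => c₁ * (‖y - z‖ ^ 2 / 2) + c₂ * u y + c₃)
      (c₁ • innerSL ℝ (x - z) + c₂ • fderiv ℝ u x) x :=
  (((hasFDerivAt_half_norm_sub_sq x z).const_mul c₁).add
    (hu.hasFDerivAt.const_mul c₂)).add_const c₃

lemma differentiableAt_fderiv_apply (hu : ContDiffAt ℝ 2 u x) (e : Euc N) :
    DifferentiableAt ℝ (fun y => fderiv ℝ u y e) x := by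
  have h : ContDiffAt ℝ 1 (fderiv ℝ u) x := hu.fderiv_right (by norm_num)
  exact (h.differentiableAt (by norm_num)).clm_apply (differentiableAt_const e)

lemma hessEntry_quadratic_comb (hu : ContDiffAt ℝ 2 u x) (i : Fin N) :
    hessEntry (fun y => c₁ * (‖y - z‖ ^ 2 / 2) + c₂ * u y + c₃) x i i =
      c₁ + c₂ * hessEntry u x i i := by
  have hev : (fun y => fderiv ℝ (fun y => c₁ * (‖y - z‖ ^ 2 / 2) + c₂ * u y + c₃) y
      (EuclideanSpace.single i (1 : ℝ))) =ᶠ[𝓝 x]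
      fun y => c₁ * ⟪EuclideanSpace.single i (1 : ℝ), y - z⟫
        + c₂ * fderiv ℝ u y (EuclideanSpace.single i (1 : ℝ)) := by
    filter_upwards [hu.eventually (by simp)] with y hy
    rw [(hasFDerivAt_quadratic_comb (hy.differentiableAt (by norm_num))).fderiv]
    rw [real_inner_comm]
    simp [inner_sub_left]
  unfold hessEntry
  rw [hev.fderiv_eq]
  have h1 : HasFDerivAt (fun y : Euc N => ⟪EuclideanSpace.single i (1 : ℝ), y - z⟫)
      (innerSL ℝ (EuclideanSpace.single i (1 : ℝ))) x := by
    have := ((innerSL ℝ (EuclideanSpace.single i (1 : ℝ) : Euc N)).hasFDerivAt (x := x - z)).comp x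
      ((hasFDerivAt_id (𝕜 := ℝ) x).sub_const z)
    simpa [Function.comp_def] using this
  have h2 := (differentiableAt_fderiv_apply hu (EuclideanSpace.single i (1 : ℝ))).hasFDerivAt
  refine (congrArg (fun L : Euc N →L[ℝ] ℝ => L (EuclideanSpace.single i (1 : ℝ)))
    ((h1.const_mul c₁).add (h2.const_mul c₂)).fderiv).trans ?_
  simp

lemma lap_quadratic_comb (hu : ContDiffAt ℝ 2 u x) :
    lap (fun y => c₁ * (‖y - z‖ ^ 2 / 2) + c₂ * u y + c₃) x = c₁ * N + c₂ * lap u x := by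
  simp only [lap, hessEntry_quadratic_comb hu, Finset.sum_add_distrib, Finset.mul_sum]
  simp [mul_comm]

lemma contDiffAt_quadratic_comb (hu : ContDiffAt ℝ 2 u x) :
    ContDiffAt ℝ 2 (fun y => c₁ * (‖y - z‖ ^ 2 / 2) + c₂ * u y + c₃) x := by
  have : ContDiffAt ℝ 2 (fun y : Euc N => ‖y - z‖ ^ 2) x :=
    ContDiffAt.norm_sq ℝ (contDiffAt_id.sub contDiffAt_const)
  exact ((contDiffAt_const.mul (this.div_const 2)).add (contDiffAt_const.mul hu)).add
    contDiffAt_const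

/-- Second derivative test on a line. -/
lemma deriv_deriv_nonpos_of_isLocalMax {f : ℝ → ℝ} {t : ℝ} (h : IsLocalMax f t)
    (hc : ContinuousAt f t) : deriv (deriv f) t ≤ 0 := by
  by_contra! hpos
  have hmin := isLocalMin_of_deriv_deriv_pos hpos h.deriv_eq_zero hc
  have hconst : f =ᶠ[𝓝 t] fun _ => f t := by
    filter_upwards [h, hmin] with s h1 h2 using le_antisymm h1 h2
  have := hconst.deriv.deriv_eq
  simp [this] at hpos

lemma lap_nonpos_of_isLocalMax (hu : ContDiffAt ℝ 2 u x) (h : IsLocalMax u x) :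
    lap u x ≤ 0 := by
  refine Finset.sum_nonpos fun i _ => ?_
  set e : Euc N := EuclideanSpace.single i (1 : ℝ)
  have hline : ∀ t : ℝ, HasDerivAt (fun s : ℝ => x + s • e) e t := fun t => by
    simpa using ((hasDerivAt_id t).smul_const e).const_add x
  have hlc : Tendsto (fun s : ℝ => x + s • e) (𝓝 0) (𝓝 x) := by
    have := (hline 0).continuousAt.tendsto; simpa using this
  have hd : deriv (fun s : ℝ => u (x + s • e)) =ᶠ[𝓝 0] fun s => fderiv ℝ u (x + s • e) e := by
    filter_upwards [hlc.eventually (hu.eventually (by simp))] with s hs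
    exact ((hs.differentiableAt (by norm_num)).hasFDerivAt.comp_hasDerivAt s (hline s)).deriv
  have hdd : deriv (deriv (fun s : ℝ => u (x + s • e))) 0 = hessEntry u x i i := by
    rw [hd.deriv_eq]
    have h2 := differentiableAt_fderiv_apply hu e
    have h3 : HasFDerivAt (fun y => fderiv ℝ u y e) (fderiv ℝ (fun y => fderiv ℝ u y e) x)
      (x + (0 : ℝ) • e) := by simpa using h2.hasFDerivAt
    exact (h3.comp_hasDerivAt (0 : ℝ) (hline 0)).deriv
  rw [← hdd]
  refine deriv_deriv_nonpos_of_isLocalMax ?_ ?_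
  · have : IsLocalMax u (x + (0 : ℝ) • e) := by simpa using h
    filter_upwards [hlc.eventually h] with s hs
    simpa using hs
  · have : ContinuousAt u (x + (0 : ℝ) • e) := by simpa using hu.continuousAt
    exact ContinuousAt.comp (f := fun s : ℝ => x + s • e) this (hline 0).continuousAt

lemma IsTorsion.contDiffAt (hu : IsTorsion Ω u) (hΩ : IsOpen Ω) (hx : x ∈ Ω) :
    ContDiffAt ℝ 2 u x := hu.2.1.contDiffAt (hΩ.mem_nhds hx)

lemma IsTorsion.nonpos (hN : 0 < N) (hu : IsTorsion Ω u) (hΩ : IsOpen Ω)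
    (hb : Bornology.IsBounded Ω) (hx : x ∈ closure Ω) : u x ≤ 0 := by
  obtain ⟨p, hp, hmax⟩ := hb.isCompact_closure.exists_isMaxOn ⟨x, hx⟩ hu.1
  refine (hmax hx).trans ?_
  by_cases hpΩ : p ∈ Ω
  · have hl : IsLocalMax u p :=
      (hmax.on_subset subset_closure).isLocalMax (hΩ.mem_nhds hpΩ)
    have := lap_nonpos_of_isLocalMax (hu.contDiffAt hΩ hpΩ) hl
    rw [hu.2.2.1 p hpΩ] at this
    have : (0 : ℝ) < N := by exact_mod_cast hN
    linarith
  · exact (hu.2.2.2 p ⟨hp, by rwa [hΩ.interior_eq]⟩).le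

/-- Comparison of the torsion function with that of an inscribed ball. -/
lemma IsTorsion.le_of_ball_subset (hN : 0 < N) (hu : IsTorsion Ω u) (hΩ : IsOpen Ω)
    (hb : Bornology.IsBounded Ω) {r : ℝ} (hr : 0 < r) (hball : ball x r ⊆ Ω) :
    r ^ 2 / 2 ≤ -u x := by
  have key : ∀ l : ℝ, l < 1 → 0 < l → l * (r ^ 2 / 2) ≤ -u x := by
    intro l hl hl0
    have hsub : closedBall x r ⊆ closure Ω := by
      rw [← closure_ball x hr.ne']; exact closure_mono hball
    set p : Euc N → ℝ := fun y => (-l) * (‖y - x‖ ^ 2 / 2) + 1 * u y + l * (r ^ 2 / 2) with hp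
    have hpc : ContinuousOn p (closedBall x r) := by
      have := hu.1.mono hsub
      fun_prop
    obtain ⟨q, hq, hmax⟩ := (isCompact_closedBall x r).exists_isMaxOn
      ⟨x, mem_closedBall_self hr.le⟩ hpc
    have hq0 : p q ≤ 0 := by
      rcases (mem_closedBall.1 hq).lt_or_eq with hlt | heq
      · have hloc : IsLocalMax p q := (hmax.on_subset ball_subset_closedBall).isLocalMax
          (isOpen_ball.mem_nhds hlt)
        have hc := hu.contDiffAt hΩ (hball hlt)
        have := lap_nonpos_of_isLocalMax (contDiffAt_quadratic_comb hc) hloc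
        rw [lap_quadratic_comb hc, hu.2.2.1 q (hball hlt)] at this
        have : (0 : ℝ) < N := by exact_mod_cast hN
        nlinarith
      · have := hu.nonpos hN hΩ hb (hsub hq)
        simp only [hp, ← dist_eq_norm, heq]
        linarith
    have hx0 := (hmax (mem_closedBall_self hr.le)).trans hq0
    simp only [hp] at hx0
    simp at hx0
    linarith
  refine le_of_forall_lt fun c hc => ?_
  by_contra! h
  have hr2 : 0 < r ^ 2 / 2 := by positivity
  have h1 : max (c / (r ^ 2 / 2)) 0 < 1 := max_lt ((div_lt_one hr2).2 hc) one_pos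
  obtain ⟨l, hl1, hl2⟩ := exists_between h1
  have h3 := key l hl2 ((le_max_right _ _).trans_lt hl1)
  have h4 := (div_lt_iff₀ hr2).1 ((le_max_left _ _).trans_lt hl1)
  linarith

end Calculus

section Cutoff

/-- A smooth cutoff vanishing for `τ ≤ ε` and equal to one for `2 * ε ≤ τ`. -/
def cutoff (ε τ : ℝ) : ℝ := smoothTransition (τ / ε - 1)

variable {ε τ : ℝ}

lemma contDiff_cutoff (ε : ℝ) : ContDiff ℝ 2 (cutoff ε) :=
  Real.smoothTransition.contDiff.comp ((contDiff_id.div_const ε).sub contDiff_const)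

lemma cutoff_nonneg : 0 ≤ cutoff ε τ := smoothTransition.nonneg _

lemma cutoff_le_one : cutoff ε τ ≤ 1 := smoothTransition.le_one _

lemma cutoff_eq_zero (hε : 0 < ε) (h : τ ≤ ε) : cutoff ε τ = 0 :=
  smoothTransition.zero_of_nonpos (by linarith [(div_le_one hε).2 h])

lemma cutoff_eq_one (hε : 0 < ε) (h : 2 * ε ≤ τ) : cutoff ε τ = 1 :=
  smoothTransition.one_of_one_le (by linarith [(le_div_iff₀ hε).2 h])

lemma deriv_cutoff_nonneg (hε : 0 < ε) : 0 ≤ deriv (cutoff ε) τ := by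
  refine Monotone.deriv_nonneg fun s t hst => smoothTransition.monotone ?_
  gcongr

lemma deriv_cutoff_eq_zero_of_le (hε : 0 < ε) (h : τ ≤ ε) : deriv (cutoff ε) τ = 0 := by
  refine IsLocalMin.deriv_eq_zero (Filter.Eventually.of_forall fun s => ?_)
  rw [cutoff_eq_zero hε h]; exact cutoff_nonneg

lemma deriv_cutoff_eq_zero_of_ge (hε : 0 < ε) (h : 2 * ε ≤ τ) : deriv (cutoff ε) τ = 0 := by
  refine IsLocalMax.deriv_eq_zero (Filter.Eventually.of_forall fun s => ?_)
  rw [cutoff_eq_one hε h]; exact cutoff_le_one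

lemma exists_abs_mul_deriv_cutoff_le :
    ∃ B : ℝ, 0 ≤ B ∧ ∀ ε τ : ℝ, 0 < ε → |τ * deriv (cutoff ε) τ| ≤ B := by
  have hc : Continuous (deriv smoothTransition) :=
    (smoothTransition.contDiff (n := 1)).continuous_deriv le_rfl
  obtain ⟨B, hB⟩ := isCompact_Icc.exists_bound_of_continuousOn (s := Icc (0 : ℝ) 1) hc.continuousOn
  have hB0 : 0 ≤ B := (norm_nonneg _).trans (hB 0 (by simp))
  refine ⟨2 * B, by positivity, fun ε τ hε => ?_⟩
  rcases le_total τ ε with h | h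
  · rw [deriv_cutoff_eq_zero_of_le hε h]; simpa using hB0
  rcases le_total (2 * ε) τ with h' | h'
  · rw [deriv_cutoff_eq_zero_of_ge hε h']; simpa using hB0
  have hd : deriv (cutoff ε) τ = deriv smoothTransition (τ / ε - 1) * (1 / ε) := by
    have h1 : HasDerivAt (fun t : ℝ => t / ε - 1) (1 / ε) τ :=
      ((hasDerivAt_id τ).div_const ε).sub_const 1
    exact (((smoothTransition.contDiff (n := 1)).differentiable (by norm_num)
      (τ / ε - 1)).hasDerivAt.comp τ h1).deriv
  have h2 := hB (τ / ε - 1) ⟨by linarith [(le_div_iff₀ hε).2 (by linarith : 1 * ε ≤ τ)],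
    by linarith [(div_le_iff₀ hε).2 h']⟩
  rw [hd, show τ * (deriv smoothTransition (τ / ε - 1) * (1 / ε)) =
    (τ / ε) * deriv smoothTransition (τ / ε - 1) by ring, abs_mul]
  gcongr
  · rw [abs_of_nonneg (by apply div_nonneg <;> linarith)]
    exact (div_le_iff₀ hε).2 h'
  · exact h2

end Cutoff

section Divergence

open Filter Topology

variable {N : ℕ} {Ω : Set (Euc N)} {u f : Euc N → ℝ} {x : Euc N} {ε : ℝ}

lemma gradient_apply (u : Euc N → ℝ) (x : Euc N) (i : Fin N) :
    gradient u x i = fderiv ℝ u x (EuclideanSpace.single i (1 : ℝ)) := by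
  have := InnerProductSpace.toDual_symm_apply (𝕜 := ℝ)
    (x := (EuclideanSpace.single i (1 : ℝ) : Euc N)) (y := fderiv ℝ u x)
  rw [← this, EuclideanSpace.inner_single_right]
  simp [gradient]

lemma inner_gradient (u f : Euc N → ℝ) (x : Euc N) :
    ⟪gradient u x, gradient f x⟫ = ∑ i, fderiv ℝ u x (EuclideanSpace.single i (1 : ℝ)) *
      fderiv ℝ f x (EuclideanSpace.single i (1 : ℝ)) := by
  rw [PiLp.inner_apply]
  simp only [gradient_apply]
  simp [mul_comm]

lemma integrableOn_of_eq_zero_off_compact {F : Euc N → ℝ} {K : Set (Euc N)} (hK : IsCompact K)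
    (hΩ : IsOpen Ω) (hKΩ : K ⊆ Ω) (hF : ContinuousOn F Ω) (h0 : ∀ x ∈ Ω, x ∉ K → F x = 0) :
    IntegrableOn F Ω :=
  ((hF.mono hKΩ).integrableOn_compact hK).of_forall_sdiff_eq_zero hΩ.measurableSet
    fun x hx => h0 x hx.1 hx.2

/-- The integral of a partial derivative of a compactly supported function vanishes. -/
lemma setIntegral_fderiv_eq_zero {F : Euc N → ℝ} {K : Set (Euc N)} (hK : IsCompact K)
    (hΩ : IsOpen Ω) (hKΩ : K ⊆ Ω) (hF : ContDiffOn ℝ 1 F Ω) (h0 : ∀ x ∈ Ω, x ∉ K → F x = 0)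
    (e : Euc N) : IntegrableOn (fun x => fderiv ℝ F x e) Ω ∧ ∫ x in Ω, fderiv ℝ F x e = 0 := by
  set G : Euc N → ℝ := K.indicator F with hG
  have hGK : ∀ x ∉ K, G x = 0 := fun x hx => indicator_of_notMem hx _
  have hGΩ : ∀ x ∈ Ω, G x = F x := fun x hx => by
    by_cases hxK : x ∈ K
    · exact indicator_of_mem hxK _
    · rw [hGK x hxK, h0 x hx hxK]
  have hGc : ContDiff ℝ 1 G := by
    rw [contDiff_iff_contDiffAt]
    intro x
    by_cases hx : x ∈ Ω
    · refine (hF.contDiffAt (hΩ.mem_nhds hx)).congr_of_eventuallyEq ?_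
      filter_upwards [hΩ.mem_nhds hx] with y hy using hGΩ y hy
    · refine (contDiffAt_const (c := (0 : ℝ))).congr_of_eventuallyEq ?_
      filter_upwards [hK.isClosed.isOpen_compl.mem_nhds fun h => hx (hKΩ h)] with y hy
        using hGK y hy
  have hGs : HasCompactSupport G := HasCompactSupport.intro hK hGK
  have hd : Continuous fun x => fderiv ℝ G x e :=
    (hGc.continuous_fderiv (by norm_num)).clm_apply continuous_const
  have hds : HasCompactSupport fun x => fderiv ℝ G x e := hGs.fderiv_apply ℝ e
  have hi := hd.integrable_of_hasCompactSupport hds (μ := volume)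
  have hdΩ : ∀ x ∈ Ω, fderiv ℝ G x e = fderiv ℝ F x e := fun x hx => by
    have : G =ᶠ[𝓝 x] F := by filter_upwards [hΩ.mem_nhds hx] with y hy using hGΩ y hy
    rw [this.fderiv_eq]
  have hint : ∫ x, fderiv ℝ G x e = 0 := by
    have := integral_mul_fderiv_eq_neg_fderiv_mul_of_integrable (𝕜 := ℝ) (μ := volume)
      (f := fun _ : Euc N => (1 : ℝ)) (g := G) (v := e) (by simp) (by simpa using hi)
      (by simpa using hGc.continuous.integrable_of_hasCompactSupport hGs)
      (fun x _ => differentiableAt_const _)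
      (fun x _ => hGc.differentiable (by norm_num) x)
    simpa using this
  refine ⟨hi.integrableOn.congr_fun hdΩ hΩ.measurableSet, ?_⟩
  rw [← setIntegral_congr_fun hΩ.measurableSet hdΩ,
    setIntegral_eq_integral_of_forall_compl_eq_zero, hint]
  intro x hx
  have : G =ᶠ[𝓝 x] fun _ => 0 := by
    filter_upwards [hK.isClosed.isOpen_compl.mem_nhds fun h => hx (hKΩ h)] with y hy
      using hGK y hy
  rw [this.fderiv_eq]; simp

lemma IsTorsion.isCompact_superlevel (hu : IsTorsion Ω u) (hΩ : IsOpen Ω)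
    (hb : Bornology.IsBounded Ω) (hε : 0 < ε) :
    IsCompact {x ∈ closure Ω | u x ≤ -ε} ∧ {x ∈ closure Ω | u x ≤ -ε} ⊆ Ω := by
  refine ⟨hb.isCompact_closure.of_isClosed_subset ?_ (sep_subset _ _), fun x hx => ?_⟩
  · exact hu.1.preimage_isClosed_of_isClosed isClosed_closure isClosed_Iic
  · by_contra hxΩ
    have := hu.2.2.2 x ⟨hx.1, by rwa [hΩ.interior_eq]⟩
    linarith [hx.2]

lemma continuousOn_lap (hΩ : IsOpen Ω) (hf : ContDiffOn ℝ 2 f Ω) : ContinuousOn (lap f) Ω := by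
  refine continuousOn_finsetSum _ fun i _ => ?_
  have h1 : ContDiffOn ℝ 1 (fun y => fderiv ℝ f y (EuclideanSpace.single i (1 : ℝ))) Ω :=
    (hf.fderiv_of_isOpen hΩ (by norm_num)).clm_apply contDiffOn_const
  exact (h1.continuousOn_fderiv_of_isOpen hΩ (by norm_num)).clm_apply continuousOn_const

lemma continuousOn_gradient (hΩ : IsOpen Ω) (hf : ContDiffOn ℝ 2 f Ω) :
    ContinuousOn (gradient f) Ω :=
  (InnerProductSpace.toDual ℝ (Euc N)).symm.continuous.comp_continuousOn
    (hf.continuousOn_fderiv_of_isOpen hΩ (by norm_num))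

/-- Green's identity for `f` and the torsion function, localised by a cutoff. -/
lemma IsTorsion.cutoff_green (hu : IsTorsion Ω u) (hΩ : IsOpen Ω)
    (hb : Bornology.IsBounded Ω) (hε : 0 < ε) (hf : ContDiffOn ℝ 2 f Ω) :
    ∫ x in Ω, deriv (cutoff ε) (-u x) * (f x * ‖gradient u x‖ ^ 2
      - u x * ⟪gradient u x, gradient f x⟫) =
    ∫ x in Ω, cutoff ε (-u x) * (N * f x - u x * lap f x) := by
  obtain ⟨hK, hKΩ⟩ := hu.isCompact_superlevel hΩ hb hε
  set K := {x ∈ closure Ω | u x ≤ -ε}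
  have hoff : ∀ x ∈ Ω, x ∉ K → -u x ≤ ε := fun x hx hxK => by
    by_contra! h
    exact hxK ⟨subset_closure hx, by linarith⟩
  have huc : ContinuousOn u Ω := hu.1.mono subset_closure
  have hdc : Continuous (deriv (cutoff ε)) := (contDiff_cutoff ε).continuous_deriv (by norm_num)
  have hA : IntegrableOn (fun x => deriv (cutoff ε) (-u x) * (f x * ‖gradient u x‖ ^ 2
      - u x * ⟪gradient u x, gradient f x⟫)) Ω := by
    refine integrableOn_of_eq_zero_off_compact hK hΩ hKΩ ?_ fun x hx hxK => ?_
    · have h1 := continuousOn_gradient hΩ hu.2.1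
      have h2 := continuousOn_gradient hΩ hf
      have h3 := hf.continuousOn
      exact (hdc.comp_continuousOn huc.neg).mul
        ((h3.mul (h1.norm.pow 2)).sub (huc.mul (h1.inner h2)))
    · rw [deriv_cutoff_eq_zero_of_le hε (hoff x hx hxK), zero_mul]
  have hB : IntegrableOn (fun x => cutoff ε (-u x) * (N * f x - u x * lap f x)) Ω := by
    refine integrableOn_of_eq_zero_off_compact hK hΩ hKΩ ?_ fun x hx hxK => ?_
    · exact ((contDiff_cutoff ε).continuous.comp_continuousOn huc.neg).mul
        ((continuousOn_const.mul hf.continuousOn).sub (huc.mul (continuousOn_lap hΩ hf)))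
    · rw [cutoff_eq_zero hε (hoff x hx hxK), zero_mul]
  set e : Fin N → Euc N := fun i => EuclideanSpace.single i (1 : ℝ)
  set X : Fin N → Euc N → ℝ := fun i x =>
    cutoff ε (-u x) * (f x * fderiv ℝ u x (e i) - u x * fderiv ℝ f x (e i)) with hXdef
  have hX : ∀ i, IntegrableOn (fun x => fderiv ℝ (X i) x (e i)) Ω ∧
      ∫ x in Ω, fderiv ℝ (X i) x (e i) = 0 := fun i => by
    refine setIntegral_fderiv_eq_zero hK hΩ hKΩ ?_ (fun x hx hxK => ?_) (e i)
    · have hu1 := hu.2.1.of_le (m := 1) (by norm_num)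
      have hf1 := hf.of_le (m := 1) (by norm_num)
      have hdu : ContDiffOn ℝ 1 (fun y => fderiv ℝ u y (e i)) Ω :=
        (hu.2.1.fderiv_of_isOpen hΩ (by norm_num)).clm_apply contDiffOn_const
      have hdf : ContDiffOn ℝ 1 (fun y => fderiv ℝ f y (e i)) Ω :=
        (hf.fderiv_of_isOpen hΩ (by norm_num)).clm_apply contDiffOn_const
      exact (((contDiff_cutoff ε).of_le (by norm_num)).comp_contDiffOn hu1.neg).mul
        ((hf1.mul hdu).sub (hu1.mul hdf))
    · simp [hXdef, cutoff_eq_zero hε (hoff x hx hxK)]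
  have hpt : ∀ x ∈ Ω, ∑ i, fderiv ℝ (X i) x (e i) =
      cutoff ε (-u x) * (N * f x - u x * lap f x) -
      deriv (cutoff ε) (-u x) * (f x * ‖gradient u x‖ ^ 2
        - u x * ⟪gradient u x, gradient f x⟫) := by
    intro x hx
    have hux := hu.contDiffAt hΩ hx
    have hfx := hf.contDiffAt (hΩ.mem_nhds hx)
    have hterm : ∀ i, fderiv ℝ (X i) x (e i) =
        cutoff ε (-u x) * (f x * hessEntry u x i i - u x * hessEntry f x i i) -
        deriv (cutoff ε) (-u x) * (f x * (fderiv ℝ u x (e i) * fderiv ℝ u x (e i))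
          - u x * (fderiv ℝ u x (e i) * fderiv ℝ f x (e i))) := by
      intro i
      have hu' := (hux.differentiableAt (by norm_num)).hasFDerivAt
      have hf' := (hfx.differentiableAt (by norm_num)).hasFDerivAt
      have hdu := (differentiableAt_fderiv_apply hux (e i)).hasFDerivAt
      have hdf := (differentiableAt_fderiv_apply hfx (e i)).hasFDerivAt
      have hcut := ((contDiff_cutoff ε).differentiable (by norm_num)
        (-u x)).hasDerivAt.comp_hasFDerivAt x hu'.neg
      have := hcut.mul ((hf'.mul hdu).sub (hu'.mul hdf))
      refine (congrArg (fun L : Euc N →L[ℝ] ℝ => L (e i)) this.fderiv).trans ?_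
      simp [hessEntry, e]
      ring
    simp only [hterm]
    have hl := hu.2.2.1 x hx
    simp only [lap] at hl ⊢
    rw [← real_inner_self_eq_norm_sq, inner_gradient, inner_gradient,
      Finset.sum_sub_distrib, ← Finset.mul_sum, ← Finset.mul_sum, Finset.sum_sub_distrib,
      Finset.sum_sub_distrib, ← Finset.mul_sum, ← Finset.mul_sum, ← Finset.mul_sum,
      ← Finset.mul_sum, hl]
    ring
  have h0 : ∫ x in Ω, ∑ i, fderiv ℝ (X i) x (e i) = 0 := by
    rw [integral_finsetSum _ fun i _ => (hX i).1]
    exact Finset.sum_eq_zero fun i _ => (hX i).2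
  rw [setIntegral_congr_fun hΩ.measurableSet hpt, integral_sub hB hA] at h0
  linarith

/-- Upper bound for the mass of `f |∇u|²` concentrated near the boundary. -/
lemma IsTorsion.exists_strip_integral_le (hN : 0 < N) (hu : IsTorsion Ω u) (hΩ : IsOpen Ω)
    (hb : Bornology.IsBounded Ω) (hf : ContDiffOn ℝ 2 f Ω) {M : ℝ}
    (hMu : ∀ x ∈ Ω, ‖gradient u x‖ ≤ M) (hMf : ∀ x ∈ Ω, ‖gradient f x‖ ≤ M)
    (hpos : ∀ x ∈ Ω, 0 ≤ N * f x - u x * lap f x)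
    (hint : IntegrableOn (fun x => N * f x - u x * lap f x) Ω) {δ : ℝ} (hδ : 0 < δ) :
    ∃ ε₀ > 0, ∀ ε, 0 < ε → ε < ε₀ →
      IntegrableOn (fun x => deriv (cutoff ε) (-u x) * (f x * ‖gradient u x‖ ^ 2)) Ω ∧
      ∫ x in Ω, deriv (cutoff ε) (-u x) * (f x * ‖gradient u x‖ ^ 2) ≤
        (∫ x in Ω, (N * f x - u x * lap f x)) + δ := by
  obtain ⟨B, hB0, hB⟩ := exists_abs_mul_deriv_cutoff_le
  have huc : ContinuousOn u Ω := hu.1.mono subset_closure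
  have hneg : ∀ x ∈ Ω, u x < 0 := fun x hx => by
    obtain ⟨r, hr, hball⟩ := Metric.isOpen_iff.1 hΩ x hx
    have := hu.le_of_ball_subset hN hΩ hb hr hball
    have : 0 < r ^ 2 / 2 := by positivity
    linarith
  set S : ℝ → Set (Euc N) := fun t => Ω ∩ {x | -u x ≤ t} with hS
  have hSm : ∀ t, MeasurableSet (S t) := fun t => by
    have h1 : MeasurableSet (Ω ∩ (fun x => -u x) ⁻¹' (Ioi t)) :=
      (huc.neg.isOpen_inter_preimage hΩ isOpen_Ioi).measurableSet
    convert hΩ.measurableSet.diff h1 using 1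
    ext x
    simp only [hS, mem_inter_iff, mem_ofPred_eq, mem_preimage, mem_Ioi, Set.mem_sdiff, not_and, not_lt]
    tauto
  have hSfin : ∀ t, volume (S t) < ⊤ := fun t =>
    (measure_mono inter_subset_left).trans_lt hb.measure_lt_top
  have hlim : Tendsto (fun n : ℕ => volume.real (S (1 / ((n : ℝ) + 1)))) atTop (𝓝 0) := by
    have hanti : Antitone fun n : ℕ => S (1 / ((n : ℝ) + 1)) := by
      intro m n hmn x hx
      have h1 : -u x ≤ 1 / ((n : ℝ) + 1) := hx.2
      have h2 : 1 / ((n : ℝ) + 1) ≤ 1 / ((m : ℝ) + 1) := by gcongr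
      exact ⟨hx.1, h1.trans h2⟩
    have h1 := tendsto_measure_iInter_atTop (μ := volume)
      (s := fun n : ℕ => S (1 / ((n : ℝ) + 1)))
      (fun n => (hSm _).nullMeasurableSet)
      hanti ⟨0, (hSfin _).ne⟩
    have h2 : (⋂ n : ℕ, S (1 / ((n : ℝ) + 1))) = ∅ := by
      ext x
      simp only [mem_iInter, mem_empty_iff_false, iff_false, not_forall]
      by_cases hx : x ∈ Ω
      · obtain ⟨n, hn⟩ := exists_nat_one_div_lt (neg_pos.2 (hneg x hx))
        exact ⟨n, fun h => (lt_of_lt_of_le hn h.2).false⟩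
      · exact ⟨0, fun h => hx h.1⟩
    rw [h2, measure_empty] at h1
    simpa [Measure.real, Function.comp_def] using (ENNReal.tendsto_toReal ENNReal.zero_ne_top).comp h1
  have hev := (hlim.const_mul (B * M ^ 2)).eventually_lt_const
    (show B * M ^ 2 * 0 < δ by simpa using hδ)
  obtain ⟨n, hn⟩ := hev.exists
  refine ⟨1 / (2 * ((n : ℝ) + 1)), by positivity, fun ε hε hεlt => ?_⟩
  obtain ⟨hK, hKΩ⟩ := hu.isCompact_superlevel hΩ hb hε
  set K := {x ∈ closure Ω | u x ≤ -ε}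
  have hoff : ∀ x ∈ Ω, x ∉ K → -u x ≤ ε := fun x hx hxK => by
    by_contra! h
    exact hxK ⟨subset_closure hx, by linarith⟩
  have hdc : Continuous (deriv (cutoff ε)) := (contDiff_cutoff ε).continuous_deriv (by norm_num)
  have hgu := continuousOn_gradient hΩ hu.2.1
  have hgf := continuousOn_gradient hΩ hf
  have hA1 : IntegrableOn (fun x => deriv (cutoff ε) (-u x) * (f x * ‖gradient u x‖ ^ 2)) Ω := by
    refine integrableOn_of_eq_zero_off_compact hK hΩ hKΩ ?_ fun x hx hxK => ?_
    · exact (hdc.comp_continuousOn huc.neg).mul (hf.continuousOn.mul (hgu.norm.pow 2))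
    · rw [deriv_cutoff_eq_zero_of_le hε (hoff x hx hxK), zero_mul]
  have hA2 : IntegrableOn (fun x => deriv (cutoff ε) (-u x) *
      (u x * ⟪gradient u x, gradient f x⟫)) Ω := by
    refine integrableOn_of_eq_zero_off_compact hK hΩ hKΩ ?_ fun x hx hxK => ?_
    · exact (hdc.comp_continuousOn huc.neg).mul (huc.mul (hgu.inner hgf))
    · rw [deriv_cutoff_eq_zero_of_le hε (hoff x hx hxK), zero_mul]
  refine ⟨hA1, ?_⟩
  have hgreen := hu.cutoff_green hΩ hb hε hf
  simp_rw [mul_sub (deriv (cutoff ε) _)] at hgreen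
  rw [integral_sub hA1 hA2] at hgreen
  have hE : ∫ x in Ω, deriv (cutoff ε) (-u x) * (u x * ⟪gradient u x, gradient f x⟫) ≤
      B * M ^ 2 * volume.real (S (1 / ((n : ℝ) + 1))) := by
    have hle : ∀ x ∈ Ω, deriv (cutoff ε) (-u x) * (u x * ⟪gradient u x, gradient f x⟫) ≤
        (S (1 / ((n : ℝ) + 1))).indicator (fun _ => B * M ^ 2) x := by
      intro x hx
      by_cases hxS : x ∈ S (1 / ((n : ℝ) + 1))
      · rw [indicator_of_mem hxS]
        have h1 := hB ε (-u x) hε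
        have h2 : |⟪gradient u x, gradient f x⟫| ≤ M ^ 2 := by
          refine (abs_real_inner_le_norm _ _).trans ?_
          rw [sq]
          exact mul_le_mul (hMu x hx) (hMf x hx) (norm_nonneg _)
            ((norm_nonneg _).trans (hMu x hx))
        calc _ ≤ |deriv (cutoff ε) (-u x) * (u x * ⟪gradient u x, gradient f x⟫)| := le_abs_self _
          _ = |-u x * deriv (cutoff ε) (-u x)| * |⟪gradient u x, gradient f x⟫| := by
              rw [← abs_mul, ← abs_neg]; congr 1; ring
          _ ≤ B * M ^ 2 := mul_le_mul h1 h2 (abs_nonneg _) hB0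
      · rw [indicator_of_notMem hxS]
        have h1 : 1 / ((n : ℝ) + 1) < -u x := by
          by_contra! h; exact hxS ⟨hx, h⟩
        have h2 : 2 * ε ≤ 1 / ((n : ℝ) + 1) := by
          have : 1 / (2 * ((n : ℝ) + 1)) = (1 / ((n : ℝ) + 1)) / 2 := by
            field_simp
          linarith
        rw [deriv_cutoff_eq_zero_of_ge hε (h2.trans h1.le), zero_mul]
    have hi : Integrable ((S (1 / ((n : ℝ) + 1))).indicator fun _ : Euc N => B * M ^ 2) volume :=
      (integrable_indicator_iff (hSm _)).2 (integrableOn_const (hSfin _).ne)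
    refine (setIntegral_mono_on hA2 hi.integrableOn hΩ.measurableSet hle).trans ?_
    rw [setIntegral_indicator (hSm _), setIntegral_const, smul_eq_mul, mul_comm]
    gcongr
    · exact (hSfin _).ne
    · exact inter_subset_right
  have hR : ∫ x in Ω, cutoff ε (-u x) * (N * f x - u x * lap f x) ≤
      ∫ x in Ω, (N * f x - u x * lap f x) := by
    refine setIntegral_mono_on ?_ hint hΩ.measurableSet fun x hx => ?_
    · refine integrableOn_of_eq_zero_off_compact hK hΩ hKΩ ?_ fun x hx hxK => ?_
      · exact ((contDiff_cutoff ε).continuous.comp_continuousOn huc.neg).mul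
          ((continuousOn_const.mul hf.continuousOn).sub (huc.mul (continuousOn_lap hΩ hf)))
      · rw [cutoff_eq_zero hε (hoff x hx hxK), zero_mul]
    · exact mul_le_of_le_one_left (hpos x hx) cutoff_le_one
  linarith

end Divergence

section ConeGeometry

open Filter Topology

variable {N : ℕ} {Ω : Set (Euc N)} {u : Euc N → ℝ}

/-- Near `x`, translating along the direction `ω` stays inside `Ω`, quantitatively. -/
def ConeDir (κ a : ℝ) (Ω : Set (Euc N)) (x ω : Euc N) : Prop :=
  ‖ω‖ = 1 ∧ ∀ w ∈ ball x a ∩ closure Ω, ∀ t : ℝ, 0 < t → 2 * t ≤ a →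
    ball (w + t • ω) (κ * t) ⊆ Ω

theorem UnifConeCond.exists_coneDir {θ a : ℝ} (hθ : θ ∈ Ioc (0 : ℝ) (π / 2))
    (h : UnifConeCond θ a Ω) {x : Euc N} (hx : x ∈ frontier Ω) :
    ∃ ω, ConeDir (Real.sin θ) a Ω x ω := by
  obtain ⟨ω, hω, H⟩ := h x hx
  refine ⟨ω, hω, fun w hw t ht hta p hp => ?_⟩
  obtain ⟨v, rfl⟩ : ∃ v, p = w + (t • ω + v) := ⟨p - w - t • ω, by abel⟩
  have hs0 : 0 < Real.sin θ := Real.sin_pos_of_pos_of_lt_pi hθ.1 (by linarith [hθ.2, Real.pi_pos])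
  have hs1 : Real.sin θ ≤ 1 := Real.sin_le_one θ
  have hc0 : 0 ≤ Real.cos θ := Real.cos_nonneg_of_mem_Icc ⟨by linarith [hθ.1, Real.pi_pos], hθ.2⟩
  have hsc := Real.sin_sq_add_cos_sq θ
  have hv : ‖v‖ < Real.sin θ * t := by
    rwa [mem_ball_iff_norm, show w + (t • ω + v) - (w + t • ω) = v by abel] at hp
  have hα : |⟪v, ω⟫| ≤ ‖v‖ := by
    have := abs_real_inner_le_norm v ω
    rwa [hω, mul_one] at this
  have hvt : ‖v‖ < t := by nlinarith
  have hin : ⟪t • ω + v, ω⟫ = t + ⟪v, ω⟫ := by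
    rw [inner_add_left, inner_smul_left, real_inner_self_eq_norm_sq, hω]
    simp
  have hnorm : ‖t • ω + v‖ ^ 2 = t ^ 2 + 2 * t * ⟪v, ω⟫ + ‖v‖ ^ 2 := by
    rw [norm_add_sq_real, norm_smul, hω, inner_smul_left, real_inner_comm]
    simp
    ring
  set α := ⟪v, ω⟫ with hαd
  have hpos : 0 < t + α := by linarith [neg_abs_le α]
  refine H w hw _ ?_ ?_
  · rw [hin]
    rcases hc0.eq_or_lt with hc | hc
    · rw [← hc]
      simpa using hpos
    · refine lt_of_pow_lt_pow_left₀ 2 hpos.le ?_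
      rw [mul_pow, hnorm]
      have h1 : ‖v‖ ^ 2 < (Real.sin θ * t) ^ 2 := by
        gcongr
      have h2 : Real.cos θ ^ 2 = 1 - Real.sin θ ^ 2 := by linarith
      have h3 : 0 < Real.cos θ ^ 2 := by positivity
      have h4 : Real.cos θ ^ 2 * ‖v‖ ^ 2 < Real.cos θ ^ 2 * (Real.sin θ * t) ^ 2 := by
        gcongr
      rw [h2] at h4 ⊢
      nlinarith [sq_nonneg (α + Real.sin θ ^ 2 * t)]
  · calc ‖t • ω + v‖ ≤ ‖t • ω‖ + ‖v‖ := norm_add_le _ _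
      _ < t + t := by
        rw [norm_smul, hω, Real.norm_eq_abs, abs_of_pos ht]
        linarith
      _ ≤ a := by linarith

theorem enorm_sub_le_lintegral_enorm_deriv {φ φ' : ℝ → ℝ} {a b : ℝ} (hab : a ≤ b)
    (h : ∀ t ∈ Icc a b, HasDerivAt φ (φ' t) t) (hc : ContinuousOn φ' (Icc a b)) :
    ‖φ b - φ a‖ₑ ≤ ∫⁻ t in Icc a b, ‖φ' t‖ₑ := by
  have h1 : ∫ t in a..b, φ' t = φ b - φ a :=
    intervalIntegral.integral_eq_sub_of_hasDerivAt (fun t ht => h t (by rwa [uIcc_of_le hab] at ht))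
      (hc.intervalIntegrable_of_Icc hab)
  rw [← h1, intervalIntegral.integral_of_le hab]
  exact (enorm_integral_le_lintegral_enorm _).trans (lintegral_mono_set Ioc_subset_Icc_self)

theorem setLIntegral_comp_add_right_le {F : Euc N → ENNReal}
    {A S : Set (Euc N)} (hA : MeasurableSet A) (hS : MeasurableSet S) {e : Euc N}
    (h : ∀ w ∈ A, w + e ∈ S) : ∫⁻ w in A, F (w + e) ≤ ∫⁻ w in S, F w := by
  rw [← lintegral_indicator hA, ← lintegral_indicator hS,
    ← lintegral_add_right_eq_self (S.indicator F) e]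
  refine lintegral_mono fun w => ?_
  by_cases hw : w ∈ A
  · rw [indicator_of_mem hw, indicator_of_mem (h w hw)]
  · rw [indicator_of_notMem hw]
    exact zero_le

theorem lintegral_lintegral_segment_le {F : Euc N → ENNReal} (hF : Measurable F)
    {A S : Set (Euc N)} (hA : MeasurableSet A) (hS : MeasurableSet S) {e : Euc N} {L : ℝ}
    (h : ∀ w ∈ A, ∀ t ∈ Icc 0 L, w + t • e ∈ S) :
    ∫⁻ w in A, ∫⁻ t in Icc 0 L, F (w + t • e) ≤ ENNReal.ofReal L * ∫⁻ w in S, F w := by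
  rw [lintegral_lintegral_swap]
  · calc ∫⁻ t in Icc 0 L, ∫⁻ w in A, F (w + t • e)
        ≤ ∫⁻ _ in Icc 0 L, ∫⁻ w in S, F w :=
          setLIntegral_mono measurable_const fun t ht =>
            setLIntegral_comp_add_right_le hA hS fun w hw => h w hw t ht
      _ = _ := by
        rw [setLIntegral_const, Real.volume_Icc, sub_zero, mul_comm]
  · exact (hF.comp (by fun_prop)).aemeasurable

theorem exists_first_exit (hΩ : IsOpen Ω) {w e : Euc N} {L : ℝ} (hw : w ∈ Ω) (hL : 0 ≤ L)
    (hwL : w + L • e ∉ Ω) :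
    ∃ T ∈ Ioc 0 L, w + T • e ∈ frontier Ω ∧ ∀ t ∈ Ico 0 T, w + t • e ∈ Ω := by
  set f : ℝ → Euc N := fun t => w + t • e with hf
  have hfc : Continuous f := by fun_prop
  have hK : IsCompact (Icc 0 L ∩ f ⁻¹' Ωᶜ) :=
    isCompact_Icc.inter_right (hΩ.isClosed_compl.preimage hfc)
  obtain ⟨T, hT, hmin⟩ := hK.exists_isLeast ⟨L, ⟨hL, le_rfl⟩, hwL⟩
  have hT0 : 0 < T := by
    refine hT.1.1.lt_of_ne fun h0 => hT.2 ?_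
    rw [← h0]
    simpa [hf] using hw
  have hin : ∀ t ∈ Ico 0 T, f t ∈ Ω := fun t ht => by
    by_contra hn
    exact absurd (hmin ⟨⟨ht.1, ht.2.le.trans hT.1.2⟩, hn⟩) (not_le.2 ht.2)
  refine ⟨T, ⟨hT0, hT.1.2⟩, ?_, hin⟩
  rw [hΩ.frontier_eq]
  refine ⟨?_, hT.2⟩
  have hTc : T ∈ closure (Ico 0 T) := by
    rw [closure_Ico hT0.ne]
    exact ⟨hT0.le, le_rfl⟩
  exact map_mem_closure (f := f) hfc hTc hin

end ConeGeometry

section StripDensity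

open Filter Topology

variable {N : ℕ} {Ω : Set (Euc N)} {u : Euc N → ℝ}

theorem measurable_indicator_of_continuousOn {E β : Type*} [TopologicalSpace E] [MeasurableSpace E]
    [OpensMeasurableSpace E] [TopologicalSpace β] [MeasurableSpace β] [BorelSpace β] [Zero β]
    {s : Set E} {f : E → β} (hs : MeasurableSet s) (hf : ContinuousOn f s) :
    Measurable (s.indicator f) := by
  classical
  rw [← piecewise_eq_indicator]
  exact hf.measurable_piecewise continuousOn_const hs

/-- The density `(cutoff ε)'(-u) ‖∇u‖²`, concentrated near the boundary. -/
def stripDensity (Ω : Set (Euc N)) (u : Euc N → ℝ) (ε : ℝ) : Euc N → ENNReal :=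
  Ω.indicator fun x => ENNReal.ofReal (deriv (cutoff ε) (-u x) * ‖gradient u x‖ ^ 2)

theorem IsTorsion.measurable_stripDensity (hu : IsTorsion Ω u) (hΩ : IsOpen Ω) (ε : ℝ) :
    Measurable (stripDensity Ω u ε) := by
  refine measurable_indicator_of_continuousOn hΩ.measurableSet ?_
  refine ENNReal.continuous_ofReal.comp_continuousOn ?_
  refine ContinuousOn.mul ?_ ((continuousOn_gradient hΩ hu.2.1).norm.pow 2)
  exact ((contDiff_cutoff ε).continuous_deriv (by norm_num)).comp_continuousOn
    hu.2.1.continuousOn.neg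

theorem IsTorsion.one_le_lintegral_stripDensity (hu : IsTorsion Ω u) (hΩ : IsOpen Ω) {ε m : ℝ}
    (hε : 0 < ε) (hm : 0 < m) (hgrad : ∀ x ∈ Ω, -u x ≤ 2 * ε → m / 2 ≤ ‖gradient u x‖)
    {w e : Euc N} {L : ℝ} (hw : w ∈ Ω) (hwε : 2 * ε ≤ -u w) (he : ‖e‖ = 1) (hL : 0 ≤ L)
    (hwL : w + L • e ∉ Ω) :
    1 ≤ ENNReal.ofReal (2 / m) * ∫⁻ t in Icc 0 L, stripDensity Ω u ε (w + t • e) := by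
  obtain ⟨T, hT, hTf, hTin⟩ := exists_first_exit hΩ hw hL hwL
  have hpath : Continuous fun t : ℝ => w + t • e := by fun_prop
  have hzero : u (w + T • e) = 0 := hu.2.2.2 _ hTf
  have hcont : ContinuousOn (fun t : ℝ => -u (w + t • e)) (Icc 0 T) := by
    refine (hu.1.comp hpath.continuousOn fun t ht => ?_).neg
    rcases ht.2.eq_or_lt with rfl | h
    · exact frontier_subset_closure hTf
    · exact subset_closure (hTin t ⟨ht.1, h⟩)
  obtain ⟨t₁, ht₁, hut₁⟩ : ∃ t₁ ∈ Ico 0 T, -u (w + t₁ • e) < ε := by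
    have h1 : ∀ᶠ t in 𝓝[Icc 0 T] T, -u (w + t • e) < ε :=
      (hcont T ⟨hT.1.le, le_rfl⟩).eventually_lt_const (by simp [hzero, hε])
    have h2 : ∀ᶠ t in 𝓝[<] T, t ∈ Ico 0 T := Ico_mem_nhdsLT hT.1
    have h3 : 𝓝[<] T ≤ 𝓝[Icc 0 T] T := by
      rw [← nhdsWithin_Ico_eq_nhdsLT hT.1]
      exact nhdsWithin_mono _ Ico_subset_Icc_self
    obtain ⟨t, ht, ht'⟩ := ((h1.filter_mono h3).and h2).exists
    exact ⟨t, ht', ht⟩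
  have hin : ∀ t ∈ Icc 0 t₁, w + t • e ∈ Ω := fun t ht => hTin t ⟨ht.1, ht.2.trans_lt ht₁.2⟩
  have hcd : Continuous (deriv (cutoff ε)) := (contDiff_cutoff ε).continuous_deriv (by norm_num)
  set φ' : ℝ → ℝ := fun t => deriv (cutoff ε) (-u (w + t • e)) * -(fderiv ℝ u (w + t • e) e)
  have hderiv : ∀ t ∈ Icc 0 t₁, HasDerivAt (fun t => cutoff ε (-u (w + t • e))) (φ' t) t := by
    intro t ht
    have h1 : HasDerivAt (fun t : ℝ => w + t • e) e t := by
      simpa using ((hasDerivAt_id t).smul_const e).const_add w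
    have h2 : HasFDerivAt u (fderiv ℝ u (w + t • e)) (w + t • e) :=
      ((hu.contDiffAt hΩ (hin t ht)).differentiableAt (by norm_num)).hasFDerivAt
    have h3 : HasDerivAt (cutoff ε) (deriv (cutoff ε) (-u (w + t • e))) (-u (w + t • e)) :=
      ((contDiff_cutoff ε).differentiable (by norm_num) _).hasDerivAt
    exact HasDerivAt.comp (h₂ := cutoff ε) (h := fun t => -u (w + t • e)) t h3
      (h2.comp_hasDerivAt t h1).neg
  have hc' : ContinuousOn φ' (Icc 0 t₁) := by
    refine (hcd.comp_continuousOn (hcont.mono (Icc_subset_Icc_right ht₁.2.le))).mul ?_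
    refine ContinuousOn.neg ?_
    have h1 : ContinuousOn (fderiv ℝ u) Ω := hu.2.1.continuousOn_fderiv_of_isOpen hΩ (by norm_num)
    exact (h1.comp hpath.continuousOn hin).clm_apply continuousOn_const
  have key := enorm_sub_le_lintegral_enorm_deriv ht₁.1 hderiv hc'
  have hone : ‖cutoff ε (-u (w + t₁ • e)) - cutoff ε (-u (w + (0 : ℝ) • e))‖ₑ = 1 := by
    rw [cutoff_eq_zero hε hut₁.le, zero_smul, add_zero, cutoff_eq_one hε hwε]
    simp
  rw [hone] at key
  refine key.trans ?_
  rw [← lintegral_const_mul' _ _ ENNReal.ofReal_ne_top]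
  refine (setLIntegral_mono' measurableSet_Icc fun t ht => ?_).trans
    (lintegral_mono_set (Icc_subset_Icc_right (ht₁.2.le.trans hT.2)))
  rw [stripDensity, indicator_of_mem (hin t ht), ← ENNReal.ofReal_mul (by positivity),
    Real.enorm_eq_ofReal_abs]
  refine ENNReal.ofReal_le_ofReal ?_
  set p := w + t • e
  have hd0 : 0 ≤ deriv (cutoff ε) (-u p) := deriv_cutoff_nonneg hε
  by_cases hp : -u p ≤ 2 * ε
  · have hg := hgrad p (hin t ht) hp
    have h1 : |fderiv ℝ u p e| ≤ ‖gradient u p‖ := by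
      have h := (fderiv ℝ u p).le_opNorm e
      rw [he, mul_one] at h
      rw [gradient, LinearIsometryEquiv.norm_map]
      exact h
    rw [abs_mul, abs_of_nonneg hd0, abs_neg]
    have h2 : ‖gradient u p‖ ≤ 2 / m * ‖gradient u p‖ ^ 2 := by
      rw [div_mul_eq_mul_div, le_div_iff₀ hm]
      nlinarith [norm_nonneg (gradient u p)]
    calc _ ≤ deriv (cutoff ε) (-u p) * (2 / m * ‖gradient u p‖ ^ 2) := by
          gcongr
          exact h1.trans h2
      _ = _ := by ring
  · have : φ' t = 0 := by
      simp only [φ']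
      rw [deriv_cutoff_eq_zero_of_ge hε (not_le.1 hp).le, zero_mul]
    rw [this, abs_zero]
    positivity

theorem IsTorsion.volume_ball_le_lintegral_stripDensity (hN : 0 < N) (hu : IsTorsion Ω u)
    (hΩ : IsOpen Ω) (hb : Bornology.IsBounded Ω) {ε m κ a s : ℝ} (hκ : κ ∈ Ioc (0 : ℝ) 1)
    (hε : 0 < ε) (hm : 0 < m) (hgrad : ∀ x ∈ Ω, -u x ≤ 2 * ε → m / 2 ≤ ‖gradient u x‖)
    (hs : 0 < s) (hsa : 8 * s ≤ a) (hεs : 16 * ε ≤ κ ^ 2 * s ^ 2) {y ω : Euc N}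
    (hy : y ∈ frontier Ω) (hω : ConeDir κ a Ω y ω) :
    volume (ball (y + s • ω) (κ * s / 2)) ≤
      ENNReal.ofReal (4 * s / m) * ∫⁻ x in ball y (4 * s), stripDensity Ω u ε x := by
  have hκs : κ * s ≤ s := by nlinarith [hκ.2]
  have hκs0 : 0 < κ * s := mul_pos hκ.1 hs
  have hyc : y ∈ ball y a ∩ closure Ω :=
    ⟨mem_ball_self (by linarith), frontier_subset_closure hy⟩
  have hyΩ : y ∉ Ω := by
    rw [hΩ.frontier_eq] at hy
    exact hy.2
  have hbig : ball (y + s • ω) (κ * s) ⊆ Ω := hω.2 y hyc s hs (by linarith)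
  have hnω : ∀ t : ℝ, ‖t • ω‖ = |t| := fun t => by rw [norm_smul, hω.1, mul_one, Real.norm_eq_abs]
  have key : ∀ w ∈ ball (y + s • ω) (κ * s / 2), 1 ≤ ENNReal.ofReal (2 / m) *
      ∫⁻ t in Icc 0 (2 * s), stripDensity Ω u ε (w + t • (-ω)) := by
    intro w hw
    have hwb : ball w (κ * s / 2) ⊆ Ω := by
      refine (ball_subset_ball' ?_).trans hbig
      rw [mem_ball] at hw
      linarith
    refine hu.one_le_lintegral_stripDensity hΩ hε hm hgrad (hwb (mem_ball_self (by positivity))) ?_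
      (by rw [norm_neg, hω.1]) (by positivity) ?_
    · have := hu.le_of_ball_subset hN hΩ hb (by positivity) hwb
      nlinarith
    · intro hmem
      have hd : ‖w - (y + s • ω)‖ < κ * s / 2 := by rwa [mem_ball_iff_norm] at hw
      refine hyΩ (hω.2 _ ⟨?_, subset_closure hmem⟩ s hs (by linarith) ?_)
      · rw [mem_ball_iff_norm]
        calc ‖w + (2 * s) • -ω - y‖ = ‖(w - (y + s • ω)) + (-s) • ω‖ := by
              congr 1
              module
          _ ≤ ‖w - (y + s • ω)‖ + ‖(-s) • ω‖ := norm_add_le _ _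
          _ < a := by
              rw [hnω, abs_neg, abs_of_pos hs]
              linarith
      · rw [mem_ball_iff_norm]
        calc ‖y - (w + (2 * s) • -ω + s • ω)‖ = ‖-(w - (y + s • ω))‖ := by
              congr 1
              module
          _ < κ * s := by
              rw [norm_neg]
              linarith
  calc volume (ball (y + s • ω) (κ * s / 2))
      = ∫⁻ _ in ball (y + s • ω) (κ * s / 2), 1 := by simp
    _ ≤ ∫⁻ w in ball (y + s • ω) (κ * s / 2), ENNReal.ofReal (2 / m) *
          ∫⁻ t in Icc 0 (2 * s), stripDensity Ω u ε (w + t • (-ω)) :=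
        setLIntegral_mono' measurableSet_ball key
    _ = ENNReal.ofReal (2 / m) * ∫⁻ w in ball (y + s • ω) (κ * s / 2),
          ∫⁻ t in Icc 0 (2 * s), stripDensity Ω u ε (w + t • (-ω)) :=
        lintegral_const_mul' _ _ ENNReal.ofReal_ne_top
    _ ≤ ENNReal.ofReal (2 / m) * (ENNReal.ofReal (2 * s) *
          ∫⁻ x in ball y (4 * s), stripDensity Ω u ε x) := by
        gcongr
        refine lintegral_lintegral_segment_le (hu.measurable_stripDensity hΩ ε) measurableSet_ball
          measurableSet_ball fun w hw t ht => ?_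
        rw [mem_ball_iff_norm] at hw ⊢
        calc ‖w + t • -ω - y‖ = ‖(w - (y + s • ω)) + (s - t) • ω‖ := by
              congr 1
              module
          _ ≤ ‖w - (y + s • ω)‖ + ‖(s - t) • ω‖ := norm_add_le _ _
          _ < 4 * s := by
              rw [hnω]
              have : |s - t| ≤ s := abs_le.2 ⟨by linarith [ht.2], by linarith [ht.1]⟩
              linarith
    _ = _ := by
        rw [← mul_assoc, ← ENNReal.ofReal_mul (by positivity)]
        congr 2
        ring

end StripDensity

section BoundaryMeasure

open Filter Topology

theorem hausdorffMeasure_le_liminf_of_le_ball {X : Type*} [MetricSpace X] [MeasurableSpace X]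
    [BorelSpace X] [SecondCountableTopology X] {A : Set X} {k : ℕ} {ρ : ℕ → ℝ} (hρ : ∀ n, 0 < ρ n)
    (hlim : Tendsto ρ atTop (𝓝 0)) {ν : ℕ → Measure X} {c : ENNReal}
    (h : ∀ n, ∀ y ∈ A, ENNReal.ofReal (ρ n) ^ k ≤ c * ν n (ball y (ρ n))) :
    μH[k] A ≤ liminf (fun n => 10 ^ k * c * ν n (⋃ y ∈ A, ball y (ρ n))) atTop := by
  have hv : ∀ n, ∃ v ⊆ A, (v.PairwiseDisjoint fun y => closedBall y (ρ n)) ∧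
      ∀ y ∈ A, ∃ b ∈ v, closedBall y (ρ n) ⊆ closedBall b (5 * ρ n) := fun n =>
    Vitali.exists_disjoint_subfamily_covering_enlargement_closedBall A id (fun _ => ρ n) (ρ n)
      (fun _ _ => le_rfl) 5 (by norm_num)
  choose v hvA hdisj hcov using hv
  have hdisj' : ∀ n, (v n).PairwiseDisjoint fun y => ball y (ρ n) := fun n =>
    (hdisj n).mono fun _ => ball_subset_closedBall
  have hcount : ∀ n, (v n).Countable := fun n =>
    (hdisj' n).countable_of_isOpen (fun _ _ => isOpen_ball) fun y _ => ⟨y, mem_ball_self (hρ n)⟩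
  have : ∀ n, Countable (v n) := fun n => (hcount n).to_subtype
  have hdiam : ∀ n (b : v n), ediam (closedBall (b : X) (5 * ρ n)) ≤ 10 * ENNReal.ofReal (ρ n) := by
    intro n b
    rw [← closedEBall_ofReal (by linarith [hρ n])]
    refine ediam_closedEBall_le.trans_eq ?_
    rw [ENNReal.ofReal_mul (by norm_num), ← mul_assoc]
    congr 1
    norm_num
  have h0 : Tendsto (fun n => 10 * ENNReal.ofReal (ρ n)) atTop (𝓝 0) := by
    have := ENNReal.Tendsto.const_mul (a := 10) (ENNReal.tendsto_ofReal hlim)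
      (Or.inr (by norm_num))
    simpa using this
  refine (Measure.hausdorffMeasure_le_liminf_tsum (ι := fun n => v n) k A _ h0
    (fun n b => closedBall (b : X) (5 * ρ n)) (Eventually.of_forall hdiam)
    (Eventually.of_forall fun n y hy => ?_)).trans ?_
  · obtain ⟨b, hb, hyb⟩ := hcov n y hy
    exact mem_iUnion.2 ⟨⟨b, hb⟩, hyb (mem_closedBall_self (hρ n).le)⟩
  · refine liminf_le_liminf (Eventually.of_forall fun n => ?_)
    calc ∑' b : v n, ediam (closedBall (b : X) (5 * ρ n)) ^ (k : ℝ)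
        ≤ ∑' b : v n, 10 ^ k * c * ν n (ball (b : X) (ρ n)) := by
          refine ENNReal.tsum_le_tsum fun b => ?_
          rw [ENNReal.rpow_natCast, mul_assoc]
          calc _ ≤ (10 * ENNReal.ofReal (ρ n)) ^ k := by
                gcongr
                exact hdiam n b
            _ ≤ _ := by
                rw [mul_pow]
                gcongr
                exact h n b (hvA n b.2)
      _ = 10 ^ k * c * ν n (⋃ y ∈ v n, ball y (ρ n)) := by
          rw [ENNReal.tsum_mul_left,
            measure_biUnion (hcount n) (hdisj' n) fun _ _ => measurableSet_ball]
      _ ≤ _ := by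
          exact mul_le_mul_right (measure_mono (biUnion_subset_biUnion_left (hvA n))) _

theorem setLIntegral_le_liminf_of_le_thickening {X : Type*} [PseudoMetricSpace X]
    [MeasurableSpace X] [OpensMeasurableSpace X] {μ : Measure X} {ν : ℕ → Measure X}
    {K Ω : Set X} (hK : MeasurableSet K) (hν : ∀ n, ν n Ωᶜ = 0)
    {c : ENNReal} (hc : c ≠ ⊤) {ρ : ℕ → ℝ}
    (h : ∀ A ⊆ K, μ A ≤ liminf (fun n => c * ν n (⋃ y ∈ A, ball y (ρ n))) atTop)
    {f : X → ℝ} (hf : Measurable f) (hf0 : 0 ≤ f) {η : ℝ} (hη : 0 ≤ η)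
    (hclose : ∀ n, ∀ x ∈ K, ∀ y ∈ Ω, dist y x < ρ n → f x ≤ f y + η) :
    ∫⁻ x in K, ENNReal.ofReal (f x) ∂μ ≤
      liminf (fun n => c * ∫⁻ x, ENNReal.ofReal (f x + η) ∂(ν n)) atTop := by
  have hmono : ∀ n, Antitone fun t : ℝ => c * ν n {y | t < f y + η} := fun n s t hst => by
    dsimp only
    gcongr
  calc ∫⁻ x in K, ENNReal.ofReal (f x) ∂μ
      = ∫⁻ t in Ioi 0, μ.restrict K {x | t < f x} :=
        lintegral_eq_lintegral_meas_lt _ (ae_of_all _ hf0) hf.aemeasurable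
    _ ≤ ∫⁻ t in Ioi (0 : ℝ), liminf (fun n => c * ν n {y | t < f y + η}) atTop := by
        refine lintegral_mono fun t => ?_
        rw [Measure.restrict_apply' hK]
        refine (h _ inter_subset_right).trans (liminf_le_liminf (Eventually.of_forall fun n => ?_))
        refine mul_le_mul_right (?_ : ν n _ ≤ ν n _) c
        refine measure_mono_ae ?_
        have : ∀ᵐ y ∂(ν n), y ∈ Ω := hν n
        filter_upwards [this] with y hy hyU
        obtain ⟨x, hx, hxy⟩ := mem_iUnion₂.1 hyU
        exact lt_of_lt_of_le hx.1 (hclose n x hx.2 y hy hxy)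
    _ ≤ liminf (fun n => ∫⁻ t in Ioi (0 : ℝ), c * ν n {y | t < f y + η}) atTop :=
        lintegral_liminf_le fun n => (hmono n).measurable
    _ = _ := by
        congr 1
        ext n
        rw [lintegral_const_mul' _ _ hc, lintegral_eq_lintegral_meas_lt (ν n)
          (ae_of_all _ fun x => add_nonneg (hf0 x) hη) (hf.add_const η).aemeasurable]

end BoundaryMeasure

section TraceInequality

open Filter Topology

variable {N : ℕ} {Ω : Set (Euc N)} {u v : Euc N → ℝ} {x : Euc N}

theorem hasFDerivAt_sq_add_const (hv : DifferentiableAt ℝ v x) (η : ℝ) :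
    HasFDerivAt (fun y => v y ^ 2 + η) ((2 * v x) • fderiv ℝ v x) x := by
  simpa using (hv.hasFDerivAt.pow 2).add_const η

theorem gradient_sq_add_const (hv : DifferentiableAt ℝ v x) (η : ℝ) :
    gradient (fun y => v y ^ 2 + η) x = (2 * v x) • gradient v x := by
  rw [gradient, (hasFDerivAt_sq_add_const hv η).fderiv, map_smul, gradient]

theorem hessEntry_sq_add_const (hv : ContDiffAt ℝ 2 v x) (η : ℝ) (i : Fin N) :
    hessEntry (fun y => v y ^ 2 + η) x i i =
      2 * fderiv ℝ v x (EuclideanSpace.single i (1 : ℝ)) ^ 2 + 2 * v x * hessEntry v x i i := by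
  have hd : ∀ᶠ y in 𝓝 x, DifferentiableAt ℝ v y :=
    (hv.eventually (by simp)).mono fun y hy => hy.differentiableAt (by norm_num)
  have heq : (fun y => fderiv ℝ (fun y => v y ^ 2 + η) y (EuclideanSpace.single i (1 : ℝ)))
      =ᶠ[𝓝 x] fun y => 2 * v y * fderiv ℝ v y (EuclideanSpace.single i (1 : ℝ)) := by
    filter_upwards [hd] with y hy
    rw [(hasFDerivAt_sq_add_const hy η).fderiv]
    simp
  have h1 := (hv.differentiableAt (by norm_num)).hasFDerivAt
  have h2 := (differentiableAt_fderiv_apply hv (EuclideanSpace.single i (1 : ℝ))).hasFDerivAt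
  have h3 : HasFDerivAt
      (fun y => 2 * v y * fderiv ℝ v y (EuclideanSpace.single i (1 : ℝ))) _ x :=
    (h1.const_mul 2).mul h2
  rw [hessEntry, heq.fderiv_eq, h3.fderiv]
  simp [hessEntry]
  ring

theorem lap_sq_add_const (hv : ContDiffAt ℝ 2 v x) (hlap : lap v x = 0) (η : ℝ) :
    lap (fun y => v y ^ 2 + η) x = 2 * ‖gradient v x‖ ^ 2 := by
  rw [lap] at hlap ⊢
  simp only [hessEntry_sq_add_const hv, Finset.sum_add_distrib, ← Finset.mul_sum, hlap]
  rw [EuclideanSpace.norm_sq_eq]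
  simp [gradient_apply]

theorem IsTorsion.exists_le_norm_gradient (hN : 0 < N) (hu : IsTorsion Ω u) (hΩ : IsOpen Ω)
    (hb : Bornology.IsBounded Ω) {g : Euc N → Euc N} (hg : ContinuousOn g (closure Ω))
    (hgu : ∀ x ∈ Ω, g x = gradient u x) {m : ℝ} (hm : 0 < m)
    (hgm : ∀ x ∈ frontier Ω, m ≤ ‖g x‖) :
    ∃ ε > 0, ∀ x ∈ Ω, -u x ≤ ε → m / 2 ≤ ‖gradient u x‖ := by
  have hK : IsCompact (closure Ω) := hb.isCompact_closure
  set S := closure Ω ∩ {x | ‖g x‖ ≤ m / 2}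
  have hS : IsCompact S := by
    refine hK.of_isClosed_subset ?_ inter_subset_left
    exact (hg.norm.preimage_isClosed_of_isClosed isClosed_closure isClosed_Iic)
  have hpos : ∀ x ∈ S, 0 < -u x := by
    intro x hx
    have hxΩ : x ∈ Ω := by
      by_contra hn
      have := hgm x (by rw [hΩ.frontier_eq]; exact ⟨hx.1, hn⟩)
      have h2 : ‖g x‖ ≤ m / 2 := hx.2
      linarith
    obtain ⟨r, hr, hball⟩ := Metric.isOpen_iff.1 hΩ x hxΩ
    have := hu.le_of_ball_subset hN hΩ hb hr hball
    have : 0 < r ^ 2 / 2 := by positivity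
    linarith
  rcases S.eq_empty_or_nonempty with h | h
  · refine ⟨1, one_pos, fun x hx _ => ?_⟩
    by_contra! hlt
    rw [← hgu x hx] at hlt
    have : x ∈ S := ⟨subset_closure hx, hlt.le⟩
    rw [h] at this
    exact this
  · obtain ⟨x₀, hx₀, hmin⟩ := hS.exists_isMinOn h (hu.1.neg.mono inter_subset_left)
    refine ⟨-u x₀ / 2, half_pos (hpos x₀ hx₀), fun x hx hxu => ?_⟩
    by_contra! hlt
    rw [← hgu x hx] at hlt
    have : x ∈ S := ⟨subset_closure hx, hlt.le⟩
    have h1 : -u x₀ ≤ -u x := hmin this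
    linarith [hpos x₀ hx₀]

/-- The constant in the weighted trace inequality. -/
def traceConst (N : ℕ) (κ m : ℝ) : ENNReal :=
  10 ^ (N - 1) * (ENNReal.ofReal ((8 / κ) ^ N / m) * (volume (ball (0 : Euc N) 1))⁻¹)

theorem traceConst_ne_top (N : ℕ) (κ m : ℝ) : traceConst N κ m ≠ ⊤ := by
  refine ENNReal.mul_ne_top (by simp) (ENNReal.mul_ne_top ENNReal.ofReal_ne_top ?_)
  exact ENNReal.inv_ne_top.2 (measure_ball_pos volume _ one_pos).ne'

theorem IsTorsion.ofReal_pow_le_stripDensity (hN : 0 < N) (hu : IsTorsion Ω u)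
    (hΩ : IsOpen Ω) (hb : Bornology.IsBounded Ω) {ε m κ a s : ℝ} (hκ : κ ∈ Ioc (0 : ℝ) 1)
    (hε : 0 < ε) (hm : 0 < m) (hgrad : ∀ x ∈ Ω, -u x ≤ 2 * ε → m / 2 ≤ ‖gradient u x‖)
    (hs : 0 < s) (hsa : 8 * s ≤ a) (hεs : 16 * ε ≤ κ ^ 2 * s ^ 2) {y ω : Euc N}
    (hy : y ∈ frontier Ω) (hω : ConeDir κ a Ω y ω) :
    ENNReal.ofReal (4 * s) ^ (N - 1) ≤
      (ENNReal.ofReal ((8 / κ) ^ N / m) * (volume (ball (0 : Euc N) 1))⁻¹) *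
        ∫⁻ x in ball y (4 * s), stripDensity Ω u ε x := by
  have hκ0 := hκ.1
  have key := hu.volume_ball_le_lintegral_stripDensity hN hΩ hb hκ hε hm hgrad hs hsa hεs hy hω
  rw [Measure.addHaar_ball_of_pos volume _ (by positivity), finrank_euclideanSpace_fin] at key
  set V := volume (ball (0 : Euc N) 1)
  have hV0 : V ≠ 0 := (measure_ball_pos volume _ one_pos).ne'
  have hVt : V ≠ ⊤ := measure_ball_lt_top.ne
  obtain ⟨k, rfl⟩ : ∃ k, N = k + 1 := ⟨N - 1, by omega⟩
  calc ENNReal.ofReal (4 * s) ^ (k + 1 - 1)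
      = ENNReal.ofReal ((8 / κ) ^ (k + 1) / (4 * s)) *
          (ENNReal.ofReal ((κ * s / 2) ^ (k + 1)) * V) * V⁻¹ := by
        rw [mul_assoc, mul_assoc, ENNReal.mul_inv_cancel hV0 hVt, mul_one,
          ← ENNReal.ofReal_mul (by positivity), ← ENNReal.ofReal_pow (by positivity)]
        congr 1
        rw [div_mul_eq_mul_div, ← mul_pow, show 8 / κ * (κ * s / 2) = 4 * s by field_simp; norm_num]
        rw [pow_succ]
        field_simp
        simp
    _ ≤ ENNReal.ofReal ((8 / κ) ^ (k + 1) / (4 * s)) * (ENNReal.ofReal (4 * s / m) *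
          ∫⁻ x in ball y (4 * s), stripDensity Ω u ε x) * V⁻¹ := by
        gcongr
    _ = _ := by
        rw [← mul_assoc, ← ENNReal.ofReal_mul (by positivity),
          show (8 / κ) ^ (k + 1) / (4 * s) * (4 * s / m) = (8 / κ) ^ (k + 1) / m by field_simp]
        ring

end TraceInequality

section TraceInequality

open Filter Topology

variable {N : ℕ} {Ω : Set (Euc N)} {u v : Euc N → ℝ}

theorem IsTorsion.exists_lintegral_stripDensity_le (hN : 0 < N) (hu : IsTorsion Ω u)
    (hΩ : IsOpen Ω) (hb : Bornology.IsBounded Ω) (hvc : ContinuousOn v (closure Ω))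
    (hv : ContDiffOn ℝ 2 v Ω) (hlap : ∀ x ∈ Ω, lap v x = 0) {M : ℝ}
    (hMu : ∀ x ∈ Ω, ‖gradient u x‖ ≤ M) (hMv : ∀ x ∈ Ω, ‖gradient v x‖ ≤ M)
    {η : ℝ} (hη : 0 < η) :
    ∃ ε₀ > 0, ∀ ε, 0 < ε → ε < ε₀ →
      ∫⁻ x, stripDensity Ω u ε x * ENNReal.ofReal ((closure Ω).indicator (fun x => v x ^ 2) x + η)
        ≤ ENNReal.ofReal ((∫ x in Ω, (N * v x ^ 2 + 2 * ((-u x) * ‖gradient v x‖ ^ 2))) +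
          (N * volume.real Ω + 1) * η) := by
  have hvd : ∀ x ∈ Ω, ContDiffAt ℝ 2 v x := fun x hx => hv.contDiffAt (hΩ.mem_nhds hx)
  have hK : IsCompact (closure Ω) := hb.isCompact_closure
  obtain ⟨B, hB⟩ := hK.exists_bound_of_continuousOn hvc
  obtain ⟨U, hU⟩ := hK.exists_bound_of_continuousOn hu.1
  have hvol : volume Ω < ⊤ := hb.measure_lt_top
  set f : Euc N → ℝ := fun x => v x ^ 2 + η with hf
  have hfC : ContDiffOn ℝ 2 f Ω := (hv.pow 2).add contDiffOn_const
  have hlapf : ∀ x ∈ Ω, lap f x = 2 * ‖gradient v x‖ ^ 2 := fun x hx =>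
    lap_sq_add_const (hvd x hx) (hlap x hx) η
  have hnp : ∀ x ∈ Ω, u x ≤ 0 := fun x hx => hu.nonpos hN hΩ hb (subset_closure hx)
  set G : Euc N → ℝ := fun x => N * v x ^ 2 + 2 * ((-u x) * ‖gradient v x‖ ^ 2) with hG
  have heq : ∀ x ∈ Ω, N * f x - u x * lap f x = G x + N * η := fun x hx => by
    rw [hlapf x hx, hf, hG]
    ring
  have hGint : IntegrableOn G Ω := by
    have hc : ContinuousOn G Ω := by
      have h1 := continuousOn_gradient hΩ hv
      have h2 := hu.1.mono (subset_closure (s := Ω))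
      have h3 := hvc.mono (subset_closure (s := Ω))
      fun_prop
    refine IntegrableOn.of_bound hvol (hc.aestronglyMeasurable hΩ.measurableSet)
      (N * B ^ 2 + 2 * (U * M ^ 2)) ?_
    refine (ae_restrict_iff' hΩ.measurableSet).2 (ae_of_all _ fun x hx => ?_)
    have h1 := hB x (subset_closure hx)
    have h2 := hU x (subset_closure hx)
    have h3 := hMv x hx
    have hB0 := (norm_nonneg _).trans h1
    have hU0 := (norm_nonneg _).trans h2
    have h4 : v x ^ 2 ≤ B ^ 2 := by
      rw [← sq_abs]
      exact pow_le_pow_left₀ (abs_nonneg _) h1 2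
    have h5 : -u x ≤ U := (neg_le_abs _).trans h2
    have h6 := hnp x hx
    rw [Real.norm_eq_abs, abs_of_nonneg (by simp only [hG]; have := neg_nonneg.2 h6; positivity)]
    simp only [hG]
    gcongr
  have hGη : IntegrableOn (fun x => G x + N * η) Ω := hGint.add (integrableOn_const hvol.ne)
  obtain ⟨ε₀, hε₀, H⟩ := hu.exists_strip_integral_le (f := f) (M := max M (2 * B * M)) hN hΩ hb hfC
    (fun x hx => (hMu x hx).trans (le_max_left _ _))
    (fun x hx => by
      rw [hf, gradient_sq_add_const ((hvd x hx).differentiableAt (by norm_num)), norm_smul]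
      refine le_trans ?_ (le_max_right _ _)
      have h1 := hB x (subset_closure hx)
      have hB0 := (norm_nonneg _).trans h1
      rw [norm_mul, Real.norm_ofNat]
      gcongr
      exact hMv x hx)
    (fun x hx => by
      rw [hlapf x hx]
      have := neg_nonneg.2 (hnp x hx)
      have h : 0 ≤ N * f x + (-u x) * (2 * ‖gradient v x‖ ^ 2) := by positivity
      linarith)
    (hGη.congr_fun (fun x hx => (heq x hx).symm) hΩ.measurableSet) hη
  refine ⟨ε₀, hε₀, fun ε hε hεε₀ => ?_⟩
  obtain ⟨hint, hle⟩ := H ε hε hεε₀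
  have hval : (∫ x in Ω, (N * f x - u x * lap f x)) + η =
      (∫ x in Ω, G x) + (N * volume.real Ω + 1) * η := by
    rw [setIntegral_congr_fun hΩ.measurableSet heq, integral_add hGint (integrableOn_const hvol.ne),
      setIntegral_const, smul_eq_mul]
    ring
  rw [hval] at hle
  refine le_trans (le_of_eq ?_) (ENNReal.ofReal_le_ofReal hle)
  rw [ofReal_integral_eq_lintegral_ofReal hint, ← lintegral_indicator hΩ.measurableSet]
  · congr 1
    ext x
    by_cases hx : x ∈ Ω
    · have : 0 ≤ deriv (cutoff ε) (-u x) := deriv_cutoff_nonneg hε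
      rw [indicator_of_mem hx, stripDensity, indicator_of_mem hx,
        indicator_of_mem (subset_closure hx), ← ENNReal.ofReal_mul (by positivity)]
      congr 1
      simp only [hf]
      ring
    · rw [indicator_of_notMem hx, stripDensity, indicator_of_notMem hx, zero_mul]
  · refine (ae_restrict_iff' hΩ.measurableSet).2 (ae_of_all _ fun x hx => ?_)
    have : 0 ≤ deriv (cutoff ε) (-u x) := deriv_cutoff_nonneg hε
    simp only [hf, Pi.zero_apply]
    positivity

theorem IsTorsion.lintegral_frontier_sq_le_add (hN : 0 < N) (hu : IsTorsion Ω u)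
    (hΩ : IsOpen Ω) (hb : Bornology.IsBounded Ω) {κ a m : ℝ} (hκ : κ ∈ Ioc (0 : ℝ) 1) (ha : 0 < a)
    (hm : 0 < m) (hcone : ∀ y ∈ frontier Ω, ∃ ω, ConeDir κ a Ω y ω)
    {g : Euc N → Euc N} (hg : ContinuousOn g (closure Ω)) (hgu : ∀ x ∈ Ω, g x = gradient u x)
    (hgm : ∀ x ∈ frontier Ω, m ≤ ‖g x‖) (hvc : ContinuousOn v (closure Ω))
    (hv : ContDiffOn ℝ 2 v Ω) (hlap : ∀ x ∈ Ω, lap v x = 0) {M : ℝ}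
    (hMu : ∀ x ∈ Ω, ‖gradient u x‖ ≤ M) (hMv : ∀ x ∈ Ω, ‖gradient v x‖ ≤ M)
    {η : ℝ} (hη : 0 < η) :
    ∫⁻ x in frontier Ω, ENNReal.ofReal (v x ^ 2) ∂μH[(N - 1 : ℕ)] ≤
      traceConst N κ m * ENNReal.ofReal
        ((∫ x in Ω, (N * v x ^ 2 + 2 * ((-u x) * ‖gradient v x‖ ^ 2))) +
          (N * volume.real Ω + 1) * η) := by
  obtain ⟨hκ0, hκ1⟩ := hκ
  have hK : IsCompact (closure Ω) := hb.isCompact_closure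
  obtain ⟨ε₁, hε₁, hgrad⟩ := hu.exists_le_norm_gradient hN hΩ hb hg hgu hm hgm
  obtain ⟨ε₀, hε₀, H⟩ :=
    hu.exists_lintegral_stripDensity_le hN hΩ hb hvc hv hlap hMu hMv hη
  obtain ⟨r₀, hr₀, hunif⟩ := Metric.uniformContinuousOn_iff.1
    (hK.uniformContinuousOn_of_continuous (hvc.pow 2)) η hη
  obtain ⟨S, hS0, hS⟩ : ∃ S > 0, S ≤ 1 ∧ 8 * S ≤ a ∧ S ≤ ε₁ ∧ S ≤ ε₀ ∧ 4 * S ≤ r₀ := by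
    refine ⟨min (min 1 (a / 8)) (min (min ε₁ ε₀) (r₀ / 4)), by positivity, ?_⟩
    set S := min (min 1 (a / 8)) (min (min ε₁ ε₀) (r₀ / 4))
    have h1 : S ≤ 1 := (min_le_left _ _).trans (min_le_left _ _)
    have h2 : S ≤ a / 8 := (min_le_left _ _).trans (min_le_right _ _)
    have h3 : S ≤ ε₁ := (min_le_right _ _).trans ((min_le_left _ _).trans (min_le_left _ _))
    have h4 : S ≤ ε₀ := (min_le_right _ _).trans ((min_le_left _ _).trans (min_le_right _ _))
    have h5 : S ≤ r₀ / 4 := (min_le_right _ _).trans (min_le_right _ _)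
    exact ⟨h1, by linarith, h3, h4, by linarith⟩
  set s : ℕ → ℝ := fun n => S / (n + 1) with hs
  have hs0 : ∀ n, 0 < s n := fun n => by positivity
  have hsS : ∀ n, s n ≤ S := fun n => div_le_self hS0.le (by linarith [n.cast_nonneg (α := ℝ)])
  set ε : ℕ → ℝ := fun n => κ ^ 2 * s n ^ 2 / 16 with hε
  have hε0 : ∀ n, 0 < ε n := fun n => by
    have := hs0 n
    positivity
  have hεS : ∀ n, 16 * ε n ≤ S := fun n => by
    have h1 : κ ^ 2 ≤ 1 := pow_le_one₀ hκ0.le hκ1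
    have h2 : s n ^ 2 ≤ s n := by
      nlinarith [hs0 n, hsS n]
    have : 16 * ε n = κ ^ 2 * s n ^ 2 := by simp only [hε]; ring
    rw [this]
    nlinarith [hsS n, sq_nonneg (s n)]
  set ν : ℕ → Measure (Euc N) := fun n => volume.withDensity (stripDensity Ω u (ε n))
  set f : Euc N → ℝ := (closure Ω).indicator fun x => v x ^ 2
  have hfm : Measurable f :=
    measurable_indicator_of_continuousOn isClosed_closure.measurableSet (hvc.pow 2)
  have hf0 : 0 ≤ f := fun x => indicator_nonneg (fun _ _ => sq_nonneg _) x
  have hlim : Tendsto (fun n => 4 * s n) atTop (𝓝 0) := by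
    have h1 : Tendsto (fun n : ℕ => (4 * S) * (1 / ((n : ℝ) + 1))) atTop (𝓝 ((4 * S) * 0)) :=
      tendsto_one_div_add_atTop_nhds_zero_nat.const_mul _
    rw [mul_zero] at h1
    refine h1.congr fun n => ?_
    simp only [hs]
    ring
  have hball : ∀ A ⊆ frontier Ω, μH[(N - 1 : ℕ)] A ≤
      liminf (fun n => traceConst N κ m * ν n (⋃ y ∈ A, ball y (4 * s n))) atTop := by
    intro A hA
    refine hausdorffMeasure_le_liminf_of_le_ball (fun n => by have := hs0 n; positivity) hlim
      fun n y hy => ?_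
    obtain ⟨ω, hω⟩ := hcone y (hA hy)
    rw [withDensity_apply _ measurableSet_ball]
    refine hu.ofReal_pow_le_stripDensity hN hΩ hb ⟨hκ0, hκ1⟩ (hε0 n) hm (fun x hx hxu => ?_)
      (hs0 n) (by linarith [hsS n]) (le_of_eq ?_) (hA hy) hω
    · refine hgrad x hx ?_
      linarith [hεS n, hε0 n]
    · simp only [hε]
      ring
  calc ∫⁻ x in frontier Ω, ENNReal.ofReal (v x ^ 2) ∂μH[(N - 1 : ℕ)]
      = ∫⁻ x in frontier Ω, ENNReal.ofReal (f x) ∂μH[(N - 1 : ℕ)] := by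
        refine setLIntegral_congr_fun isClosed_frontier.measurableSet fun x hx => ?_
        simp only [f]
        rw [indicator_of_mem (frontier_subset_closure hx)]
    _ ≤ liminf (fun n => traceConst N κ m * ∫⁻ x, ENNReal.ofReal (f x + η) ∂(ν n)) atTop := by
        refine setLIntegral_le_liminf_of_le_thickening (Ω := Ω) isClosed_frontier.measurableSet
          (fun n => ?_) (traceConst_ne_top _ _ _) hball hfm hf0 hη.le fun n x hx y hy hxy => ?_
        · rw [withDensity_apply _ hΩ.measurableSet.compl]
          refine (setLIntegral_congr_fun hΩ.measurableSet.compl fun x hx => ?_).trans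
            (lintegral_zero)
          exact indicator_of_notMem hx _
        · have h1 := hunif x (frontier_subset_closure hx) y (subset_closure hy)
            (by rw [dist_comm]; linarith [hsS n])
          simp only [f]
          rw [indicator_of_mem (frontier_subset_closure hx), indicator_of_mem (subset_closure hy)]
          rw [Real.dist_eq, Pi.pow_apply, Pi.pow_apply] at h1
          linarith [le_abs_self (v x ^ 2 - v y ^ 2)]
    _ ≤ _ := by
        refine liminf_le_of_le (by isBoundedDefault) fun b hb => ?_
        obtain ⟨n, hn⟩ := hb.exists
        refine hn.trans ?_
        gcongr
        rw [lintegral_withDensity_eq_lintegral_mul _ (hu.measurable_stripDensity hΩ _)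
          (by fun_prop)]
        exact H (ε n) (hε0 n) (by linarith [hεS n, hε0 n])

theorem IsTorsion.lintegral_frontier_sq_le (hN : 0 < N) (hu : IsTorsion Ω u)
    (hΩ : IsOpen Ω) (hb : Bornology.IsBounded Ω) {κ a m : ℝ} (hκ : κ ∈ Ioc (0 : ℝ) 1) (ha : 0 < a)
    (hm : 0 < m) (hcone : ∀ y ∈ frontier Ω, ∃ ω, ConeDir κ a Ω y ω)
    {g : Euc N → Euc N} (hg : ContinuousOn g (closure Ω)) (hgu : ∀ x ∈ Ω, g x = gradient u x)
    (hgm : ∀ x ∈ frontier Ω, m ≤ ‖g x‖) (hvc : ContinuousOn v (closure Ω))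
    (hv : ContDiffOn ℝ 2 v Ω) (hlap : ∀ x ∈ Ω, lap v x = 0) {M : ℝ}
    (hMu : ∀ x ∈ Ω, ‖gradient u x‖ ≤ M) (hMv : ∀ x ∈ Ω, ‖gradient v x‖ ≤ M) :
    ∫⁻ x in frontier Ω, ENNReal.ofReal (v x ^ 2) ∂μH[(N - 1 : ℕ)] ≤
      traceConst N κ m * ENNReal.ofReal
        (∫ x in Ω, (N * v x ^ 2 + 2 * ((-u x) * ‖gradient v x‖ ^ 2))) := by
  set I := ∫ x in Ω, (N * v x ^ 2 + 2 * ((-u x) * ‖gradient v x‖ ^ 2))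
  have hlim : Tendsto (fun η : ℝ => traceConst N κ m * ENNReal.ofReal
      (I + (N * volume.real Ω + 1) * η)) (𝓝[>] 0) (𝓝 (traceConst N κ m * ENNReal.ofReal I)) := by
    refine ENNReal.Tendsto.const_mul (ENNReal.tendsto_ofReal ?_)
      (Or.inr (traceConst_ne_top _ _ _))
    have : Continuous fun η : ℝ => I + (N * volume.real Ω + 1) * η := by fun_prop
    exact tendsto_nhdsWithin_of_tendsto_nhds (this.tendsto' _ _ (by simp))
  refine ge_of_tendsto hlim (eventually_mem_nhdsWithin.mono fun η hη => ?_)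
  exact hu.lintegral_frontier_sq_le_add hN hΩ hb hκ ha hm hcone hg hgu hgm hvc hv hlap hMu hMv hη

end TraceInequality

section OneDimensionalHardy

open Filter Topology

theorem sq_lintegral_mul_le {α : Type*} [MeasurableSpace α] {μ : Measure α} {f g : α → ENNReal}
    (hf : AEMeasurable f μ) (hg : AEMeasurable g μ) :
    (∫⁻ x, f x * g x ∂μ) ^ 2 ≤ (∫⁻ x, f x ^ 2 ∂μ) * ∫⁻ x, g x ^ 2 ∂μ := by
  have h := ENNReal.lintegral_mul_le_Lp_mul_Lq μ Real.HolderConjugate.two_two hf hg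
  simp only [Pi.mul_apply, ENNReal.rpow_two] at h
  calc _ ≤ ((∫⁻ x, f x ^ 2 ∂μ) ^ (1 / 2 : ℝ) * (∫⁻ x, g x ^ 2 ∂μ) ^ (1 / 2 : ℝ)) ^ 2 := by
        gcongr
    _ = _ := by
        rw [mul_pow, ← ENNReal.rpow_mul_natCast, ← ENNReal.rpow_mul_natCast]
        norm_num

theorem lintegral_Ioi_rpow {t : ℝ} (ht : 0 < t) :
    ∫⁻ s in Ioi t, ENNReal.ofReal (s ^ (-(3 / 2) : ℝ)) = ENNReal.ofReal (2 * t ^ (-(1 / 2) : ℝ)) := by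
  rw [← ofReal_integral_eq_lintegral_ofReal (integrableOn_Ioi_rpow_of_lt (by norm_num) ht),
    integral_Ioi_rpow_of_lt (by norm_num) ht]
  · congr 1
    norm_num
    ring
  · filter_upwards [ae_restrict_mem measurableSet_Ioi] with s hs
    exact Real.rpow_nonneg (ht.trans hs).le _

theorem lintegral_Ioo_rpow {s : ℝ} (hs : 0 < s) :
    ∫⁻ t in Ioo 0 s, ENNReal.ofReal (2 * t ^ (-(1 / 2) : ℝ)) =
      ENNReal.ofReal (4 * s ^ (1 / 2 : ℝ)) := by
  have hint : IntervalIntegrable (fun t : ℝ => 2 * t ^ (-(1 / 2) : ℝ)) volume 0 s :=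
    (intervalIntegral.intervalIntegrable_rpow' (by norm_num)).const_mul 2
  rw [setLIntegral_congr Ioo_ae_eq_Ioc, ← ofReal_integral_eq_lintegral_ofReal,
    ← intervalIntegral.integral_of_le hs.le,
    intervalIntegral.integral_const_mul, integral_rpow (Or.inl (by norm_num))]
  · congr 1
    norm_num
    ring
  · exact (intervalIntegrable_iff_integrableOn_Ioc_of_le hs.le).1 hint
  · filter_upwards [ae_restrict_mem measurableSet_Ioc] with t ht
    have := Real.rpow_nonneg ht.1.le (-(1 / 2) : ℝ)
    simp only [Pi.zero_apply]
    positivity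

theorem lintegral_sq_lintegral_Ioi_le {q : ℝ → ENNReal} (hq : Measurable q) :
    ∫⁻ t in Ioi 0, (∫⁻ s in Ioi t, q s) ^ 2 ≤
      4 * ∫⁻ s in Ioi 0, ENNReal.ofReal (s ^ 2) * q s ^ 2 := by
  have hpt : ∀ t ∈ Ioi (0 : ℝ), (∫⁻ s in Ioi t, q s) ^ 2 ≤
      ∫⁻ s in Ioi 0, (Ioo 0 s).indicator (fun t => ENNReal.ofReal (2 * t ^ (-(1 / 2) : ℝ))) t *
        (ENNReal.ofReal (s ^ (3 / 2 : ℝ)) * q s ^ 2) := by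
    intro t ht
    have ht' : (0 : ℝ) < t := ht
    have h1 : ∫⁻ s in Ioi t, q s = ∫⁻ s in Ioi t, ENNReal.ofReal (s ^ (-(3 / 4) : ℝ)) *
        (ENNReal.ofReal (s ^ (3 / 4 : ℝ)) * q s) := by
      refine setLIntegral_congr_fun measurableSet_Ioi fun s hs => ?_
      have hs0 : 0 < s := ht'.trans hs
      rw [← mul_assoc, ← ENNReal.ofReal_mul (by positivity), ← Real.rpow_add hs0]
      norm_num
    have h2 : ∫⁻ s in Ioi t, ENNReal.ofReal (s ^ (-(3 / 4) : ℝ)) ^ 2 =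
        ENNReal.ofReal (2 * t ^ (-(1 / 2) : ℝ)) := by
      rw [← lintegral_Ioi_rpow ht']
      refine setLIntegral_congr_fun measurableSet_Ioi fun s hs => ?_
      have hs0 : 0 < s := ht'.trans hs
      rw [← ENNReal.ofReal_pow (by positivity), ← Real.rpow_mul_natCast hs0.le]
      norm_num
    have h3 : ∫⁻ s in Ioi t, (ENNReal.ofReal (s ^ (3 / 4 : ℝ)) * q s) ^ 2 =
        ∫⁻ s in Ioi t, ENNReal.ofReal (s ^ (3 / 2 : ℝ)) * q s ^ 2 := by
      refine setLIntegral_congr_fun measurableSet_Ioi fun s hs => ?_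
      have hs0 : 0 < s := ht'.trans hs
      rw [mul_pow, ← ENNReal.ofReal_pow (by positivity), ← Real.rpow_mul_natCast hs0.le]
      norm_num
    rw [h1]
    refine (sq_lintegral_mul_le (by fun_prop) (by fun_prop)).trans ?_
    rw [h2, h3, ← lintegral_const_mul' _ _ ENNReal.ofReal_ne_top]
    refine (setLIntegral_mono' measurableSet_Ioi fun s hs => ?_).trans
      (lintegral_mono_set (Ioi_subset_Ioi ht'.le))
    rw [indicator_of_mem (show t ∈ Ioo 0 s from ⟨ht', hs⟩)]
  refine (setLIntegral_mono' measurableSet_Ioi hpt).trans ?_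
  rw [lintegral_lintegral_swap, ← lintegral_const_mul' _ _ (by norm_num)]
  · refine setLIntegral_mono' measurableSet_Ioi fun s hs => ?_
    have hs0 : (0 : ℝ) < s := hs
    rw [lintegral_mul_const _ (Measurable.indicator (by fun_prop) measurableSet_Ioo),
      lintegral_indicator measurableSet_Ioo, Measure.restrict_restrict measurableSet_Ioo,
      inter_eq_left.2 Ioo_subset_Ioi_self, lintegral_Ioo_rpow hs0, ← mul_assoc,
      ← ENNReal.ofReal_mul (by positivity), mul_assoc 4, ← Real.rpow_add hs0,
      ENNReal.ofReal_mul (by norm_num), mul_assoc]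
    norm_num
  · refine Measurable.aemeasurable ?_
    refine Measurable.mul ?_ (by fun_prop)
    have : (Function.uncurry fun (x y : ℝ) =>
        (Ioo 0 y).indicator (fun t => ENNReal.ofReal (2 * t ^ (-(1 / 2) : ℝ))) x) =
        {p : ℝ × ℝ | 0 < p.1 ∧ p.1 < p.2}.indicator
          fun p => ENNReal.ofReal (2 * p.1 ^ (-(1 / 2) : ℝ)) := by
      ext p
      rfl
    simp only [Function.uncurry_def] at this
    rw [this]
    refine Measurable.indicator (by fun_prop) ?_
    exact (measurableSet_lt measurable_const measurable_fst).inter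
      (measurableSet_lt measurable_fst measurable_snd)

/-- Hardy's inequality on the half-line `(α, ∞)`. -/
theorem setLIntegral_sq_le_of_le_lintegral_Ioi {q D : ℝ → ENNReal} (hq : Measurable q) {α : ℝ}
    {T : Set ℝ} (hTm : MeasurableSet T) (hT : T ⊆ Ioi α) (hD : ∀ t ∈ T, D t ≤ ∫⁻ s in Ioi t, q s) :
    ∫⁻ t in T, D t ^ 2 ≤ 4 * ∫⁻ s in Ioi α, ENNReal.ofReal ((s - α) ^ 2) * q s ^ 2 := by
  have htr : ∀ (F : ℝ → ENNReal) (t : ℝ), ∫⁻ s in Ioi t, F (s + α) = ∫⁻ s in Ioi (t + α), F s := by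
    intro F t
    rw [← (measurePreserving_add_right volume α).setLIntegral_comp_preimage_emb
      (measurableEmbedding_addRight α) F (Ioi (t + α))]
    simp
  have h0 := lintegral_sq_lintegral_Ioi_le (q := fun s => q (s + α)) (by fun_prop)
  have h1 := htr (fun s => ENNReal.ofReal ((s - α) ^ 2) * q s ^ 2) 0
  have h2 := htr (fun t => (∫⁻ s in Ioi t, q s) ^ 2) 0
  simp only [add_sub_cancel_right, zero_add] at h1 h2
  rw [h1] at h0
  simp only [htr] at h0
  rw [h2] at h0
  refine le_trans ?_ h0
  exact (setLIntegral_mono' hTm fun t ht => by gcongr; exact hD t ht).trans (lintegral_mono_set hT)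

end OneDimensionalHardy

section Hardy

open Filter Topology

variable {N : ℕ} {Ω : Set (Euc N)} {W v : Euc N → ℝ}

/-- The weighted energy density `W ‖∇v‖²` on `Ω`, extended by zero. -/
def energyDensity (Ω : Set (Euc N)) (W v : Euc N → ℝ) : Euc N → ENNReal :=
  Ω.indicator fun x => ENNReal.ofReal (W x) * ‖fderiv ℝ v x‖ₑ ^ 2

theorem measurable_energyDensity (hΩ : IsOpen Ω) (hW : ContinuousOn W Ω)
    (hv : ContDiffOn ℝ 1 v Ω) : Measurable (energyDensity Ω W v) := by
  have h1 : ContinuousOn (fderiv ℝ v) Ω := hv.continuousOn_fderiv_of_isOpen hΩ le_rfl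
  have h2 : Measurable (Ω.indicator fun x => ENNReal.ofReal (W x)) :=
    measurable_indicator_of_continuousOn hΩ.measurableSet
      (ENNReal.continuous_ofReal.comp_continuousOn hW)
  have h3 : Measurable (Ω.indicator fun x => ‖fderiv ℝ v x‖ₑ) :=
    measurable_indicator_of_continuousOn hΩ.measurableSet h1.enorm
  convert h2.mul (h3.pow_const 2) using 1
  ext x
  by_cases hx : x ∈ Ω <;> simp [energyDensity, hx]

theorem lintegral_line_enorm_shift_sq_le (hΩ : IsOpen Ω) (hv : ContDiffOn ℝ 1 v Ω)
    {P : Set (Euc N)} (hP : MeasurableSet P) {e : Euc N} {b : ℝ} (hb : 0 < b)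
    (h : ∀ w ∈ P, ∀ t ∈ Ioc (0 : ℝ) 2, w + t • e ∈ Ω ∧ b * t ^ 2 ≤ W (w + t • e)) (x : Euc N) :
    ∫⁻ t in Icc (0 : ℝ) 1, P.indicator (fun w => ‖v (w + e) - v w‖ₑ ^ 2) (x + t • e) ≤
      ENNReal.ofReal (4 * ‖e‖ ^ 2 / b) *
        ∫⁻ t in Icc (0 : ℝ) 2, energyDensity Ω W v (x + t • e) := by
  have hpath : Continuous fun t : ℝ => x + t • e := by fun_prop
  have hPm : MeasurableSet ((fun t : ℝ => x + t • e) ⁻¹' P) := hpath.measurable hP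
  set T : Set ℝ := (fun t : ℝ => x + t • e) ⁻¹' P ∩ Icc 0 1 with hTdef
  have hTm : MeasurableSet T := hPm.inter measurableSet_Icc
  set D : ℝ → ENNReal := fun t => ‖v (x + t • e + e) - v (x + t • e)‖ₑ with hD
  have hL : ∫⁻ t in Icc (0 : ℝ) 1, P.indicator (fun w => ‖v (w + e) - v w‖ₑ ^ 2) (x + t • e) =
      ∫⁻ t in T, D t ^ 2 := by
    rw [hTdef, ← Measure.restrict_restrict hPm, ← lintegral_indicator hPm]
    rfl
  rw [hL]
  rcases T.eq_empty_or_nonempty with hT | hT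
  · simp [hT]
  have hbdd : BddBelow T := ⟨0, fun t ht => ht.2.1⟩
  set α := sInf T
  have hα0 : 0 ≤ α := le_csInf hT fun t ht => ht.2.1
  have hmem : ∀ s ∈ Ioc α 2, x + s • e ∈ Ω ∧ b * (s - α) ^ 2 ≤ W (x + s • e) := by
    intro s hs
    have hstep : ∀ t ∈ T, t < s → x + s • e ∈ Ω ∧ b * (s - t) ^ 2 ≤ W (x + s • e) := by
      intro t ht hts
      have := h _ ht.1 (s - t) ⟨by linarith, by linarith [hs.2, ht.2.1]⟩
      rwa [show x + t • e + (s - t) • e = x + s • e by module] at this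
    obtain ⟨t₀, ht₀, hts₀⟩ := exists_lt_of_csInf_lt hT hs.1
    obtain ⟨hin, hle⟩ := hstep t₀ ht₀ hts₀
    refine ⟨hin, ?_⟩
    by_contra! hlt
    have hW0 : 0 ≤ W (x + s • e) := le_trans (by positivity) hle
    have h1 : √(W (x + s • e) / b) < s - α := by
      rw [Real.sqrt_lt' (by linarith [hs.1]), div_lt_iff₀ hb]
      linarith
    obtain ⟨t, ht, hts⟩ := exists_lt_of_csInf_lt hT (show α < s - √(W (x + s • e) / b) by linarith)
    have h2 : √(W (x + s • e) / b) < s - t := by linarith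
    have h3 : 0 < s - t := (Real.sqrt_nonneg _).trans_lt h2
    rw [Real.sqrt_lt' h3, div_lt_iff₀ hb] at h2
    linarith [(hstep t ht (by linarith)).2]
  set q : ℝ → ENNReal := (Ioc α 2).indicator fun s => ‖fderiv ℝ v (x + s • e) e‖ₑ with hq
  have hfd : ContinuousOn (fderiv ℝ v) Ω := hv.continuousOn_fderiv_of_isOpen hΩ le_rfl
  have hfdp : ContinuousOn (fun s : ℝ => fderiv ℝ v (x + s • e) e) (Ioc α 2) :=
    (hfd.comp hpath.continuousOn fun s hs => (hmem s hs).1).clm_apply continuousOn_const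
  have hqm : Measurable q :=
    measurable_indicator_of_continuousOn measurableSet_Ioc hfdp.enorm
  have hDq : ∀ t ∈ T \ {α}, D t ≤ ∫⁻ s in Ioi t, q s := by
    intro t ht
    have htα : α < t := (csInf_le hbdd ht.1).lt_of_ne (Ne.symm ht.2)
    have hsub : Icc t (t + 1) ⊆ Ioc α 2 := fun s hs =>
      ⟨htα.trans_le hs.1, by linarith [hs.2, ht.1.2.2]⟩
    have hderiv : ∀ s ∈ Icc t (t + 1),
        HasDerivAt (fun s : ℝ => v (x + s • e)) (fderiv ℝ v (x + s • e) e) s := by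
      intro s hs
      have h1 : HasDerivAt (fun s : ℝ => x + s • e) e s := by
        simpa using ((hasDerivAt_id s).smul_const e).const_add x
      have h2 : DifferentiableAt ℝ v (x + s • e) :=
        (hv.contDiffAt (hΩ.mem_nhds (hmem s (hsub hs)).1)).differentiableAt (by norm_num)
      exact h2.hasFDerivAt.comp_hasDerivAt s h1
    have key := enorm_sub_le_lintegral_enorm_deriv (by linarith) hderiv (hfdp.mono hsub)
    rw [show x + (t + 1) • e = x + t • e + e by module] at key
    calc D t ≤ ∫⁻ s in Icc t (t + 1), ‖fderiv ℝ v (x + s • e) e‖ₑ := key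
      _ = ∫⁻ s in Icc t (t + 1), q s :=
          setLIntegral_congr_fun measurableSet_Icc fun s hs => by
            rw [hq, indicator_of_mem (hsub hs)]
      _ ≤ ∫⁻ s in Ici t, q s := lintegral_mono_set Icc_subset_Ici_self
      _ = ∫⁻ s in Ioi t, q s := (setLIntegral_congr Ioi_ae_eq_Ici).symm
  have hpt : ∀ s ∈ Ioi α, ENNReal.ofReal ((s - α) ^ 2) * q s ^ 2 ≤ (Ioc α 2).indicator
      (fun s => ENNReal.ofReal (‖e‖ ^ 2 / b) * energyDensity Ω W v (x + s • e)) s := by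
    intro s _
    by_cases hs : s ∈ Ioc α 2
    · obtain ⟨hin, hle⟩ := hmem s hs
      rw [hq, indicator_of_mem hs, indicator_of_mem hs, energyDensity, indicator_of_mem hin]
      have h1 : ‖fderiv ℝ v (x + s • e) e‖ₑ ≤ ‖fderiv ℝ v (x + s • e)‖ₑ * ‖e‖ₑ :=
        ContinuousLinearMap.le_opENorm _ _
      have h2 : ENNReal.ofReal ((s - α) ^ 2) * ‖e‖ₑ ^ 2 ≤
          ENNReal.ofReal (‖e‖ ^ 2 / b) * ENNReal.ofReal (W (x + s • e)) := by
        rw [← ofReal_norm, ← ENNReal.ofReal_pow (norm_nonneg _),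
          ← ENNReal.ofReal_mul (by positivity), ← ENNReal.ofReal_mul (by positivity)]
        refine ENNReal.ofReal_le_ofReal ?_
        rw [div_mul_eq_mul_div, le_div_iff₀ hb]
        nlinarith [sq_nonneg ‖e‖]
      calc _ ≤ ENNReal.ofReal ((s - α) ^ 2) * (‖fderiv ℝ v (x + s • e)‖ₑ * ‖e‖ₑ) ^ 2 := by
            gcongr
        _ = (ENNReal.ofReal ((s - α) ^ 2) * ‖e‖ₑ ^ 2) * ‖fderiv ℝ v (x + s • e)‖ₑ ^ 2 := by ring
        _ ≤ _ := by
            rw [← mul_assoc]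
            gcongr
    · rw [hq, indicator_of_notMem hs]
      simp
  calc ∫⁻ t in T, D t ^ 2 = ∫⁻ t in T \ {α}, D t ^ 2 :=
        (setLIntegral_congr (sdiff_null_ae_eq_self (measure_singleton α))).symm
    _ ≤ 4 * ∫⁻ s in Ioi α, ENNReal.ofReal ((s - α) ^ 2) * q s ^ 2 :=
        setLIntegral_sq_le_of_le_lintegral_Ioi hqm (hTm.diff (measurableSet_singleton α))
          (fun t ht => (csInf_le hbdd ht.1).lt_of_ne (Ne.symm ht.2)) hDq
    _ ≤ 4 * ∫⁻ s in Ioi α, (Ioc α 2).indicator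
          (fun s => ENNReal.ofReal (‖e‖ ^ 2 / b) * energyDensity Ω W v (x + s • e)) s := by
        exact mul_le_mul_right (setLIntegral_mono' measurableSet_Ioi hpt) _
    _ ≤ 4 * ∫⁻ s in Icc (0 : ℝ) 2, ENNReal.ofReal (‖e‖ ^ 2 / b) * energyDensity Ω W v (x + s • e) := by
        refine mul_le_mul_right ((setLIntegral_le_lintegral _ _).trans ?_) _
        rw [lintegral_indicator measurableSet_Ioc]
        exact lintegral_mono_set fun s hs => ⟨hα0.trans hs.1.le, hs.2⟩
    _ = _ := by
        rw [lintegral_const_mul' _ _ ENNReal.ofReal_ne_top, ← mul_assoc, mul_div_assoc,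
          ENNReal.ofReal_mul (by norm_num)]
        norm_num

theorem setLIntegral_enorm_shift_sq_le (hΩ : IsOpen Ω) (hW : ContinuousOn W Ω)
    (hv : ContDiffOn ℝ 1 v Ω) {P : Set (Euc N)} (hP : MeasurableSet P) (hPΩ : P ⊆ Ω) {e : Euc N}
    {b : ℝ} (hb : 0 < b)
    (h : ∀ w ∈ P, ∀ t ∈ Ioc (0 : ℝ) 2, w + t • e ∈ Ω ∧ b * t ^ 2 ≤ W (w + t • e)) :
    ∫⁻ w in P, ‖v (w + e) - v w‖ₑ ^ 2 ≤
      ENNReal.ofReal (8 * ‖e‖ ^ 2 / b) * ∫⁻ x, energyDensity Ω W v x := by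
  have hH := measurable_energyDensity hΩ hW hv
  set G : Euc N → ENNReal := P.indicator fun w => ‖v (w + e) - v w‖ₑ ^ 2
  have hG : Measurable G := by
    refine measurable_indicator_of_continuousOn hP ?_
    have h1 : ContinuousOn (fun w => v (w + e) - v w) P := by
      refine ContinuousOn.sub ?_ (hv.continuousOn.mono hPΩ)
      refine hv.continuousOn.comp (by fun_prop) fun w hw => ?_
      have := (h w hw 1 ⟨one_pos, one_le_two⟩).1
      rwa [one_smul] at this
    exact (ENNReal.continuous_pow 2).comp_continuousOn h1.enorm
  calc ∫⁻ w in P, ‖v (w + e) - v w‖ₑ ^ 2 = ∫⁻ w, G w := (lintegral_indicator hP _).symm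
    _ = ∫⁻ _ in Icc (0 : ℝ) 1, ∫⁻ w, G w := by simp
    _ = ∫⁻ t in Icc (0 : ℝ) 1, ∫⁻ x, G (x + t • e) := by
        congr 1
        ext t
        exact (lintegral_add_right_eq_self G (t • e)).symm
    _ = ∫⁻ x, ∫⁻ t in Icc (0 : ℝ) 1, G (x + t • e) :=
        lintegral_lintegral_swap (hG.comp (by fun_prop)).aemeasurable
    _ ≤ ∫⁻ x, ENNReal.ofReal (4 * ‖e‖ ^ 2 / b) *
          ∫⁻ t in Icc (0 : ℝ) 2, energyDensity Ω W v (x + t • e) :=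
        lintegral_mono fun x => lintegral_line_enorm_shift_sq_le hΩ hv hP hb h x
    _ = ENNReal.ofReal (4 * ‖e‖ ^ 2 / b) *
          ∫⁻ x, ∫⁻ t in Icc (0 : ℝ) 2, energyDensity Ω W v (x + t • e) :=
        lintegral_const_mul' _ _ ENNReal.ofReal_ne_top
    _ ≤ ENNReal.ofReal (4 * ‖e‖ ^ 2 / b) *
          (ENNReal.ofReal 2 * ∫⁻ x, energyDensity Ω W v x) := by
        gcongr
        have := lintegral_lintegral_segment_le hH (A := univ) (S := univ) MeasurableSet.univ
          MeasurableSet.univ (e := e) (L := 2) fun _ _ _ _ => mem_univ _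
        simpa using this
    _ = _ := by
        rw [← mul_assoc, ← ENNReal.ofReal_mul (by positivity)]
        congr 2
        ring

end Hardy

section LocalShift

open Filter Topology

variable {N : ℕ} {Ω : Set (Euc N)} {W v : Euc N → ℝ}

/-- The squared `L²` distance between the restrictions of `v` to two balls of radius `r`,
identified by translation. -/
def ballDist (v : Euc N → ℝ) (r : ℝ) (p q : Euc N) : ENNReal :=
  ∫⁻ x in ball (0 : Euc N) r, ‖v (p + x) - v (q + x)‖ₑ ^ 2

theorem enorm_sub_sq_le (a b c : ℝ) :
    ‖a - c‖ₑ ^ 2 ≤ 2 * (‖a - b‖ₑ ^ 2 + ‖b - c‖ₑ ^ 2) := by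
  have h (x : ℝ) : ‖x‖ₑ ^ 2 = ENNReal.ofReal (x ^ 2) := by
    rw [← ofReal_norm, ← ENNReal.ofReal_pow (norm_nonneg _), Real.norm_eq_abs, sq_abs]
  rw [h, h, h, ← ENNReal.ofReal_add (sq_nonneg _) (sq_nonneg _),
    show (2 : ENNReal) = ENNReal.ofReal 2 by simp, ← ENNReal.ofReal_mul (by norm_num)]
  exact ENNReal.ofReal_le_ofReal (by nlinarith [sq_nonneg (a - b - (b - c))])

theorem lintegral_enorm_sub_sq_le {α : Type*} [MeasurableSpace α] {μ : Measure α}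
    {f₁ f₂ f₃ : α → ℝ} (h₁ : Measurable f₁) (h₂ : Measurable f₂) :
    ∫⁻ x, ‖f₁ x - f₃ x‖ₑ ^ 2 ∂μ ≤
      2 * (∫⁻ x, ‖f₁ x - f₂ x‖ₑ ^ 2 ∂μ + ∫⁻ x, ‖f₂ x - f₃ x‖ₑ ^ 2 ∂μ) := by
  have hm : Measurable fun x => ‖f₁ x - f₂ x‖ₑ ^ 2 := by fun_prop
  rw [← lintegral_add_left hm, ← lintegral_const_mul' _ _ ENNReal.ofNat_ne_top]
  exact lintegral_mono fun x => enorm_sub_sq_le _ _ _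

theorem ballDist_comm (v : Euc N → ℝ) (r : ℝ) (p q : Euc N) :
    ballDist v r p q = ballDist v r q p := by
  simp only [ballDist, enorm_sub_rev]

theorem ballDist_self (v : Euc N → ℝ) (r : ℝ) (p : Euc N) : ballDist v r p p = 0 := by
  simp [ballDist]

theorem ballDist_triangle (hv : Measurable v) (r : ℝ) (p q l : Euc N) :
    ballDist v r p q ≤ 2 * (ballDist v r p l + ballDist v r l q) :=
  lintegral_enorm_sub_sq_le (by fun_prop) (by fun_prop)

theorem ballDist_add_le (hΩ : IsOpen Ω) (hW : ContinuousOn W Ω) (hv : ContDiffOn ℝ 1 v Ω)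
    (hWr : ∀ x r, 0 < r → ball x r ⊆ Ω → r ^ 2 / 2 ≤ W x) {p e : Euc N} {r : ℝ} (hr : 0 < r)
    (h : ∀ t ∈ Icc (0 : ℝ) 2, ball (p + t • e) (2 * r) ⊆ Ω) :
    ballDist v r p (p + e) ≤
      ENNReal.ofReal (64 * ‖e‖ ^ 2 / r ^ 2) * ∫⁻ x, energyDensity Ω W v x := by
  have hsub : ∀ w ∈ ball p r, ∀ t ∈ Icc (0 : ℝ) 2, ball (w + t • e) r ⊆ Ω := by
    intro w hw t ht
    refine (ball_subset_ball' ?_).trans (h t ht)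
    rw [dist_add_right]
    linarith [mem_ball.1 hw]
  have key := setLIntegral_enorm_shift_sq_le hΩ hW hv (P := ball p r) measurableSet_ball
    (fun w hw => hsub w hw 0 (by simp) (by simpa using hr)) (e := e) (b := r ^ 2 / 8)
    (by positivity) (fun w hw t ht => ?_)
  · calc ballDist v r p (p + e)
        = ∫⁻ x in ball (0 : Euc N) r, ‖v (x + p + e) - v (x + p)‖ₑ ^ 2 := by
          unfold ballDist
          congr! 2 with x
          rw [enorm_sub_rev, add_comm p x, show p + e + x = x + p + e by abel]
      _ ≤ ∫⁻ w in ball p r, ‖v (w + e) - v w‖ₑ ^ 2 :=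
          setLIntegral_comp_add_right_le (F := fun w => ‖v (w + e) - v w‖ₑ ^ 2)
            measurableSet_ball measurableSet_ball fun w hw => by simpa using hw
      _ ≤ _ := key
      _ = _ := by
          congr 2
          field_simp
          ring
  · have h1 := hsub w hw t ⟨ht.1.le, ht.2⟩
    refine ⟨h1 (mem_ball_self hr), le_trans ?_ (hWr _ r hr h1)⟩
    have : t ^ 2 ≤ 4 := by nlinarith [ht.1, ht.2]
    nlinarith [sq_nonneg r]

/-- Poincaré inequality on a ball, with the constant being a value of the function. -/
theorem exists_lintegral_ball_enorm_sub_sq_le (hΩ : IsOpen Ω) (hW : ContinuousOn W Ω)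
    (hvm : Measurable v) (hv : ContDiffOn ℝ 1 v Ω)
    (hWr : ∀ x r, 0 < r → ball x r ⊆ Ω → r ^ 2 / 2 ≤ W x) {p : Euc N} {r : ℝ} (hr : 0 < r)
    (h : ball p (6 * r) ⊆ Ω) :
    ∃ c : ℝ, ∫⁻ x in ball (0 : Euc N) r, ‖v (p + x) - c‖ₑ ^ 2 ≤
      volume (ball (0 : Euc N) (2 * r)) / volume (ball (0 : Euc N) r) * 256 *
        ∫⁻ x, energyDensity Ω W v x := by
  set G := ∫⁻ x, energyDensity Ω W v x
  set B := ball (0 : Euc N) r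
  have hm : Measurable fun q : Euc N × Euc N => ‖v (p + q.2) - v (p + q.1)‖ₑ ^ 2 := by fun_prop
  have hm' : Measurable fun q : Euc N × Euc N => ‖v (p + q.1) - v (p + q.2 + q.1)‖ₑ ^ 2 := by
    fun_prop
  obtain ⟨x', -, hx'⟩ := exists_le_setLAverage (μ := volume) (s := B)
    (f := fun x' => ∫⁻ x in B, ‖v (p + x) - v (p + x')‖ₑ ^ 2)
    (measure_ball_pos _ _ hr).ne' measure_ball_lt_top.ne hm.lintegral_prod_right'.aemeasurable
  refine ⟨v (p + x'), hx'.trans ?_⟩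
  rw [setLAverage_eq, ENNReal.div_eq_inv_mul, ENNReal.div_eq_inv_mul, mul_assoc, mul_assoc]
  refine mul_le_mul_right ?_ _
  calc ∫⁻ x' in B, ∫⁻ x in B, ‖v (p + x) - v (p + x')‖ₑ ^ 2
      = ∫⁻ x in B, ∫⁻ x' in B, ‖v (p + x) - v (p + x')‖ₑ ^ 2 :=
        lintegral_lintegral_swap hm.aemeasurable
    _ ≤ ∫⁻ x in B, ∫⁻ k in ball (0 : Euc N) (2 * r), ‖v (p + x) - v (p + k + x)‖ₑ ^ 2 := by
        refine setLIntegral_mono' measurableSet_ball fun x hx => ?_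
        have := setLIntegral_comp_add_right_le
          (F := fun k => ‖v (p + x) - v (p + k + x)‖ₑ ^ 2) (A := B)
          (S := ball (0 : Euc N) (2 * r)) (e := -x) measurableSet_ball measurableSet_ball ?_
        · convert this using 6 with y
          congr 1
          abel
        · intro w hw
          have h1 := mem_ball_zero_iff.1 hw
          have h2 := mem_ball_zero_iff.1 hx
          refine mem_ball_zero_iff.2 ((norm_add_le _ _).trans_lt ?_)
          rw [norm_neg]
          linarith
    _ = ∫⁻ k in ball (0 : Euc N) (2 * r), ballDist v r p (p + k) :=
        lintegral_lintegral_swap hm'.aemeasurable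
    _ ≤ ∫⁻ _ in ball (0 : Euc N) (2 * r), 256 * G := by
        refine setLIntegral_mono' measurableSet_ball fun k hk => ?_
        have hk' : ‖k‖ < 2 * r := mem_ball_zero_iff.1 hk
        refine (ballDist_add_le hΩ hW hv hWr hr (e := k) fun t ht => ?_).trans ?_
        · refine (ball_subset_ball' ?_).trans h
          rw [dist_self_add_left, norm_smul, Real.norm_of_nonneg ht.1]
          nlinarith [ht.1, ht.2, norm_nonneg k]
        · gcongr
          rw [show (256 : ENNReal) = ENNReal.ofReal 256 by simp]
          refine ENNReal.ofReal_le_ofReal ?_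
          rw [div_le_iff₀ (by positivity)]
          nlinarith [norm_nonneg k]
    _ = _ := by
        rw [setLIntegral_const]
        ring

end LocalShift

section Chaining

open Filter Topology

theorem exists_le_of_chain {ι : Type*} [DecidableEq ι] (T : Finset ι) (D : ι → ENNReal)
    (B : ENNReal) {j₀ : ι} (hj₀ : j₀ ∈ T) (h0 : D j₀ = 0)
    (hstep : ∀ S ⊆ T, S.Nonempty → S ≠ T → ∃ j ∈ S, ∃ k ∈ T \ S, D k ≤ 2 * (D j + B)) :
    ∀ k ∈ T, D k ≤ 4 ^ T.card * B := by
  have hpow {m n : ℕ} (h : m ≤ n) : (4 : ENNReal) ^ m * B ≤ 4 ^ n * B := by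
    gcongr
    norm_num
  have key : ∀ n < T.card, ∃ S ⊆ T, S.card = n + 1 ∧ ∀ k ∈ S, D k ≤ 4 ^ n * B := by
    intro n
    induction n with
    | zero => exact fun _ => ⟨{j₀}, by simpa using hj₀, by simp, by simp [h0]⟩
    | succ n ih =>
      intro hn
      obtain ⟨S, hST, hcard, hS⟩ := ih (by omega)
      obtain ⟨j, hj, k, hk, hle⟩ := hstep S hST (Finset.card_pos.1 (by omega))
        (by rintro rfl; omega)
      rw [Finset.mem_sdiff] at hk
      refine ⟨insert k S, Finset.insert_subset hk.1 hST, ?_, ?_⟩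
      · rw [Finset.card_insert_of_notMem hk.2, hcard]
      · intro l hl
        rcases Finset.mem_insert.1 hl with rfl | hl
        · calc D l ≤ 2 * (4 ^ n * B + 4 ^ n * B) := by
                refine hle.trans ?_
                gcongr
                · exact hS j hj
                · exact le_trans (by simp) (hpow (Nat.zero_le n))
            _ = _ := by ring
        · exact (hS l hl).trans (hpow n.le_succ)
  have hT : 0 < T.card := Finset.card_pos.2 ⟨j₀, hj₀⟩
  obtain ⟨S, hST, hcard, hS⟩ := key (T.card - 1) (by omega)
  rw [Finset.eq_of_subset_of_card_le hST (by omega)] at hS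
  exact fun k hk => (hS k hk).trans (hpow (Nat.sub_le _ _))

theorem IsPreconnected.exists_inter_of_finset_cover {X ι : Type*} [TopologicalSpace X]
    [DecidableEq ι] {s : Set X} (hs : IsPreconnected s) {T : Finset ι} {U : ι → Set X}
    (hU : ∀ i ∈ T, IsOpen (U i)) (hne : ∀ i ∈ T, (s ∩ U i).Nonempty)
    (hcov : ∀ x ∈ s, ∃ i ∈ T, x ∈ U i) {S : Finset ι} (hST : S ⊆ T) (hS : S.Nonempty)
    (hne' : S ≠ T) : ∃ j ∈ S, ∃ k ∈ T \ S, (s ∩ (U j ∩ U k)).Nonempty := by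
  obtain ⟨j, hj⟩ := hS
  obtain ⟨k, hk⟩ : (T \ S).Nonempty := by
    rw [Finset.sdiff_nonempty]
    exact fun h => hne' (hST.antisymm h)
  obtain ⟨x, hx, hxS, hxT⟩ := hs (⋃ i ∈ S, U i) (⋃ i ∈ T \ S, U i)
    (isOpen_biUnion fun i hi => hU i (hST hi))
    (isOpen_biUnion fun i hi => hU i (Finset.mem_sdiff.1 hi).1)
    (fun x hx => by
      obtain ⟨i, hi, hxi⟩ := hcov x hx
      by_cases hiS : i ∈ S
      · exact Or.inl (mem_biUnion hiS hxi)
      · exact Or.inr (mem_biUnion (Finset.mem_sdiff.2 ⟨hi, hiS⟩) hxi))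
    ((hne j (hST hj)).mono fun y hy => ⟨hy.1, mem_biUnion hj hy.2⟩)
    ((hne k (Finset.mem_sdiff.1 hk).1).mono fun y hy => ⟨hy.1, mem_biUnion hk hy.2⟩)
  simp only [mem_iUnion] at hxS hxT
  obtain ⟨j, hj, hxj⟩ := hxS
  obtain ⟨k, hk, hxk⟩ := hxT
  exact ⟨j, hj, k, hk, x, hx, hxj, hxk⟩

end Chaining

section Patches

open Filter Topology

variable {N : ℕ} {Ω : Set (Euc N)} {W v : Euc N → ℝ} {κ a : ℝ} {y e y' e' : Euc N}

/-- A vector `e` translating the part of `Ω` near `y` into the interior of `Ω`. -/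
structure PatchShift (κ a : ℝ) (Ω : Set (Euc N)) (y e : Euc N) : Prop where
  norm_le : ‖e‖ ≤ a / 16
  add_mem : ∀ q ∈ Ω, dist q y < a / 2 → ∀ t ∈ Ioc (0 : ℝ) 2, q + t • e ∈ Ω
  ball_subset : ball (y + e) (6 * (κ * a / 256)) ⊆ Ω
  thick : e = 0 ∨ ∀ q ∈ Ω, dist q y < a / 2 → ∀ t ∈ Ioc (0 : ℝ) 2,
    ball (q + t • e) (κ * a / 16 * t) ⊆ Ω

theorem exists_patchShift (hΩ : IsOpen Ω) (hκ : κ ∈ Ioc (0 : ℝ) 1) (ha : 0 < a)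
    (hcone : ∀ x ∈ frontier Ω, ∃ ω, ConeDir κ a Ω x ω)
    (hy : (Ω ∩ ball y (κ * a / 256)).Nonempty) : ∃ e, PatchShift κ a Ω y e := by
  obtain ⟨hκ0, hκ1⟩ := hκ
  have hκa : 0 < κ * a := mul_pos hκ0 ha
  have hκa' : κ * a ≤ a := by nlinarith
  by_cases hx : ∃ x ∈ frontier Ω, dist x y < 6 * (κ * a / 256)
  · obtain ⟨x, hx, hxy⟩ := hx
    obtain ⟨ω, hω, hball⟩ := hcone x hx
    have key : ∀ q ∈ Ω, dist q y < a / 2 → ∀ t ∈ Ioc (0 : ℝ) 2,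
        ball (q + t • (a / 16) • ω) (κ * a / 16 * t) ⊆ Ω := by
      intro q hq hqy t ht
      have hqx : q ∈ ball x a := by
        have := dist_triangle_right q x y
        rw [mem_ball]
        linarith
      have := hball q ⟨hqx, subset_closure hq⟩ (t * (a / 16)) (mul_pos ht.1 (by linarith))
        (by nlinarith [ht.2])
      rw [smul_smul]
      convert this using 2
      ring
    refine ⟨(a / 16) • ω, ?_, ?_, ?_, Or.inr key⟩
    · rw [norm_smul, hω, mul_one, Real.norm_of_nonneg (by linarith)]
    · intro q hq hqy t ht
      exact key q hq hqy t ht (mem_ball_self (by have := ht.1; positivity))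
    · have := hball x ⟨mem_ball_self ha, frontier_subset_closure hx⟩ (a / 16) (by linarith)
        (by linarith)
      refine (ball_subset_ball' ?_).trans this
      rw [dist_add_right, dist_comm]
      linarith
  · push Not at hx
    obtain ⟨w, hw, hwy⟩ := hy
    have hin : ball y (6 * (κ * a / 256)) ⊆ Ω := by
      intro q hq
      by_contra hqΩ
      obtain ⟨T, hT, hTf, -⟩ := exists_first_exit hΩ (w := w) (e := q - w) (L := 1) hw
        zero_le_one (by simpa using hqΩ)
      have hwy' : w ∈ ball y (6 * (κ * a / 256)) :=
        ball_subset_ball (by linarith) hwy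
      have hseg : w + T • (q - w) ∈ ball y (6 * (κ * a / 256)) :=
        (convex_ball y _).add_smul_sub_mem hwy' hq ⟨hT.1.le, hT.2⟩
      exact absurd (mem_ball.1 hseg) (not_lt.2 (hx _ hTf))
    refine ⟨0, by rw [norm_zero]; positivity, ?_, by simpa using hin, Or.inl rfl⟩
    intro q hq _ t _
    simpa using hq

theorem PatchShift.setLIntegral_le (hκ : κ ∈ Ioc (0 : ℝ) 1) (ha : 0 < a)
    (h : PatchShift κ a Ω y e) (hΩ : IsOpen Ω) (hW : ContinuousOn W Ω) (hv : ContDiffOn ℝ 1 v Ω)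
    (hWr : ∀ x r, 0 < r → ball x r ⊆ Ω → r ^ 2 / 2 ≤ W x) :
    ∫⁻ w in Ω ∩ ball y (κ * a / 256), ‖v w - v (w + e)‖ₑ ^ 2 ≤
      ENNReal.ofReal (16 / κ ^ 2) * ∫⁻ x, energyDensity Ω W v x := by
  obtain ⟨hκ0, hκ1⟩ := hκ
  have hκa : 0 < κ * a := mul_pos hκ0 ha
  have hκa' : κ * a ≤ a := by nlinarith
  rcases h.thick with rfl | hthick
  · simp
  simp only [enorm_sub_rev (v _) (v (_ + e))]
  refine (setLIntegral_enorm_shift_sq_le hΩ hW hv (P := Ω ∩ ball y (κ * a / 256))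
    (hΩ.measurableSet.inter measurableSet_ball) inter_subset_left (b := (κ * a / 16) ^ 2 / 2)
    (by positivity) fun w hw t ht => ?_).trans ?_
  · have hwy : dist w y < a / 2 := by linarith [mem_ball.1 hw.2]
    refine ⟨h.add_mem w hw.1 hwy t ht, ?_⟩
    have h1 := hWr _ _ (mul_pos (by positivity) ht.1) (hthick w hw.1 hwy t ht)
    linarith [mul_pow (κ * a / 16) t 2]
  · gcongr ?_ * _
    refine ENNReal.ofReal_le_ofReal ?_
    rw [div_le_div_iff₀ (by positivity) (by positivity)]
    have h1 : ‖e‖ ^ 2 ≤ (a / 16) ^ 2 := pow_le_pow_left₀ (norm_nonneg _) h.norm_le 2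
    nlinarith [mul_le_mul_of_nonneg_left h1 (sq_nonneg κ)]

theorem PatchShift.ballDist_le (hκ : κ ∈ Ioc (0 : ℝ) 1) (ha : 0 < a)
    (h : PatchShift κ a Ω y e) (h' : PatchShift κ a Ω y' e')
    (hd : dist y y' < 2 * (κ * a / 256)) (hΩ : IsOpen Ω) (hW : ContinuousOn W Ω)
    (hvm : Measurable v) (hv : ContDiffOn ℝ 1 v Ω)
    (hWr : ∀ x r, 0 < r → ball x r ⊆ Ω → r ^ 2 / 2 ≤ W x) :
    ballDist v (κ * a / 256) (y' + e') (y + e) ≤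
      10 * (ENNReal.ofReal (16384 / κ ^ 2) * ∫⁻ x, energyDensity Ω W v x) := by
  obtain ⟨hκ0, hκ1⟩ := hκ
  have hκa : 0 < κ * a := mul_pos hκ0 ha
  have hκa' : κ * a ≤ a := by nlinarith
  set ρ := κ * a / 256 with hρ
  have hρ0 : 0 < ρ := by positivity
  set X := ENNReal.ofReal (16384 / κ ^ 2) * ∫⁻ x, energyDensity Ω W v x with hX
  have hstep : ∀ p f : Euc N, ‖f‖ ≤ a / 16 → (∀ t ∈ Icc (0 : ℝ) 2, ball (p + t • f) (2 * ρ) ⊆ Ω) →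
      ballDist v ρ p (p + f) ≤ X := by
    intro p f hf hball
    refine (ballDist_add_le hΩ hW hv hWr hρ0 hball).trans ?_
    rw [hX]
    gcongr ?_ * _
    refine ENNReal.ofReal_le_ofReal ?_
    rw [div_le_div_iff₀ (by positivity) (by positivity)]
    have h1 : ‖f‖ ^ 2 ≤ (a / 16) ^ 2 := pow_le_pow_left₀ (norm_nonneg _) hf 2
    rw [hρ]
    nlinarith [mul_le_mul_of_nonneg_left h1 (sq_nonneg κ)]
  have hcross : ∀ {y e y' e' : Euc N}, PatchShift κ a Ω y e → PatchShift κ a Ω y' e' →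
      dist y y' < 2 * ρ → ∀ t ∈ Icc (0 : ℝ) 2, ball (y + e + t • e') (2 * ρ) ⊆ Ω := by
    intro y e y' e' h h' hd t ht w hw
    have hq : dist (w - t • e') (y + e) < 2 * ρ := by
      rw [mem_ball, dist_eq_norm] at hw
      rw [dist_eq_norm]
      convert hw using 2
      abel
    have hqΩ : w - t • e' ∈ Ω := h.ball_subset (ball_subset_ball (by linarith) (mem_ball.2 hq))
    rcases ht.1.eq_or_lt with rfl | ht0
    · simpa using hqΩ
    · have hqy : dist (w - t • e') y' < a / 2 := by
        have h1 := dist_triangle4 (w - t • e') (y + e) y y'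
        have h2 : dist (y + e) y = ‖e‖ := by simp
        linarith [h.norm_le]
      have := h'.add_mem _ hqΩ hqy t ⟨ht0, ht.2⟩
      rwa [sub_add_cancel] at this
  have hd' : dist y' y < 2 * ρ := by rwa [dist_comm]
  have hyy : ‖y - y'‖ < 2 * ρ := by rwa [← dist_eq_norm]
  have D₁ : ballDist v ρ (y' + e') (y' + e' + e) ≤ X :=
    hstep _ _ h.norm_le (hcross h' h hd')
  have D₂ : ballDist v ρ (y' + e' + e) (y + e + e') ≤ X := by
    have := hstep (y' + e' + e) (y - y') (by linarith) ?_
    · rwa [show y' + e' + e + (y - y') = y + e + e' by abel] at this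
    · intro t ht w hw
      have hq : dist (w - e) (y' + e') < 6 * ρ := by
        have h1 : ‖w - (y' + e' + e + t • (y - y'))‖ < 2 * ρ := by
          rwa [← dist_eq_norm]
        have h2 : ‖t • (y - y')‖ ≤ 4 * ρ := by
          rw [norm_smul, Real.norm_of_nonneg ht.1]
          nlinarith [ht.1, ht.2, norm_nonneg (y - y')]
        rw [dist_eq_norm, show w - e - (y' + e') =
          (w - (y' + e' + e + t • (y - y'))) + t • (y - y') by abel]
        exact (norm_add_le _ _).trans_lt (by linarith)
      have hqy : dist (w - e) y < a / 2 := by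
        have h1 := dist_triangle4 (w - e) (y' + e') y' y
        have h2 : dist (y' + e') y' = ‖e'‖ := by simp
        linarith [h'.norm_le]
      have := h.add_mem _ (h'.ball_subset (mem_ball.2 hq)) hqy 1 ⟨one_pos, one_le_two⟩
      rwa [one_smul, sub_add_cancel] at this
  have D₃ : ballDist v ρ (y + e + e') (y + e) ≤ X := by
    rw [ballDist_comm]
    exact hstep _ _ h'.norm_le (hcross h h' hd)
  calc ballDist v ρ (y' + e') (y + e)
      ≤ 2 * (X + 2 * (X + X)) := by
        refine (ballDist_triangle hvm _ _ _ (y' + e' + e)).trans ?_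
        gcongr
        refine (ballDist_triangle hvm _ _ _ (y + e + e')).trans ?_
        gcongr
    _ = 10 * X := by ring

end Patches

section HardyPoincare

open Filter Topology

variable {N : ℕ}

theorem lintegral_le_card_mul {α ι : Type*} [MeasurableSpace α] {μ : Measure α} {s : Set α}
    (T : Finset ι) (P : ι → Set α) (hs : s ⊆ ⋃ i ∈ T, P i) {f : α → ENNReal} {B : ENNReal}
    (h : ∀ i ∈ T, ∫⁻ x in P i, f x ∂μ ≤ B) : ∫⁻ x in s, f x ∂μ ≤ T.card * B := by
  have hs' : s ⊆ ⋃ i : T, P i := hs.trans (by rw [iUnion_subtype])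
  calc ∫⁻ x in s, f x ∂μ ≤ ∫⁻ x in ⋃ i : T, P i, f x ∂μ := lintegral_mono_set hs'
    _ ≤ ∑' i : T, ∫⁻ x in P i, f x ∂μ := lintegral_iUnion_le _ _
    _ ≤ ∑' _ : T, B := ENNReal.tsum_le_tsum fun i => h i i.2
    _ = T.card * B := by simp

theorem exists_hardyPoincare_of_measurable (N : ℕ) {κ a : ℝ} (hκ : κ ∈ Ioc (0 : ℝ) 1)
    (ha : 0 < a) (d : ℝ) :
    ∃ C : ENNReal, C ≠ ⊤ ∧ ∀ Ω : Set (Euc N), IsOpen Ω → IsConnected Ω →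
      Bornology.IsBounded Ω → Metric.diam Ω ≤ d →
      (∀ x ∈ frontier Ω, ∃ ω, ConeDir κ a Ω x ω) →
      ∀ W v : Euc N → ℝ, ContinuousOn W Ω → Measurable v → ContDiffOn ℝ 1 v Ω →
      (∀ x r, 0 < r → ball x r ⊆ Ω → r ^ 2 / 2 ≤ W x) →
      ∃ c : ℝ, ∫⁻ x in Ω, ‖v x - c‖ₑ ^ 2 ≤ C * ∫⁻ x, energyDensity Ω W v x := by
  classical
  have hκ0 := hκ.1
  set ρ := κ * a / 256 with hρ
  have hρ0 : 0 < ρ := by positivity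
  obtain ⟨t, -, htfin, htcov⟩ := (isCompact_closedBall (0 : Euc N) d).finite_cover_balls hρ0
  set n := htfin.toFinset.card
  set X := ENNReal.ofReal (16384 / κ ^ 2)
  set Q : ENNReal := volume (ball (0 : Euc N) (2 * ρ)) / volume (ball (0 : Euc N) ρ) * 256
  have hQ : Q ≠ ⊤ := ENNReal.mul_ne_top
    (ENNReal.div_ne_top measure_ball_lt_top.ne (measure_ball_pos _ _ hρ0).ne')
    ENNReal.ofNat_ne_top
  refine ⟨n * (2 * (ENNReal.ofReal (16 / κ ^ 2) + 2 * (4 ^ n * (10 * X) + Q))), by finiteness,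
    fun Ω hΩ hconn hb hdiam hcone W v hW hvm hv hWr => ?_⟩
  set E := ∫⁻ x, energyDensity Ω W v x
  obtain ⟨p, hp⟩ := hconn.nonempty
  set T := htfin.toFinset.filter fun c => (Ω ∩ ball (p + c) ρ).Nonempty with hT
  have hTn : T.card ≤ n := Finset.card_filter_le _ _
  have hTne : ∀ c ∈ T, (Ω ∩ ball (p + c) ρ).Nonempty := fun c hc => (Finset.mem_filter.1 hc).2
  have hcov : ∀ x ∈ Ω, ∃ c ∈ T, x ∈ ball (p + c) ρ := by
    intro x hx
    have h1 : x - p ∈ closedBall (0 : Euc N) d := by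
      rw [mem_closedBall_zero_iff, ← dist_eq_norm]
      exact (dist_le_diam_of_mem hb hx hp).trans hdiam
    obtain ⟨c, hc, hxc⟩ := mem_iUnion₂.1 (htcov h1)
    have hxc' : x ∈ ball (p + c) ρ := by
      rw [mem_ball, dist_eq_norm] at hxc ⊢
      rwa [← sub_sub]
    exact ⟨c, Finset.mem_filter.2 ⟨htfin.mem_toFinset.2 hc, x, hx, hxc'⟩, hxc'⟩
  have hshift : ∀ c, ∃ e, c ∈ T → PatchShift κ a Ω (p + c) e := by
    intro c
    by_cases hc : c ∈ T
    · obtain ⟨e, he⟩ := exists_patchShift hΩ hκ ha hcone (hTne c hc)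
      exact ⟨e, fun _ => he⟩
    · exact ⟨0, fun h => absurd h hc⟩
  choose e he using hshift
  obtain ⟨c₀, hc₀, -⟩ := hcov p hp
  have hchain := exists_le_of_chain T
    (fun c => ballDist v ρ (p + c₀ + e c₀) (p + c + e c)) (10 * (X * E)) hc₀
    (ballDist_self _ _ _) fun S hST hS hSne => by
      obtain ⟨j, hj, k, hk, x, hx, hxj, hxk⟩ :=
        hconn.isPreconnected.exists_inter_of_finset_cover (U := fun c => ball (p + c) ρ)
          (fun _ _ => isOpen_ball) hTne hcov hST hS hSne
      refine ⟨j, hj, k, hk, (ballDist_triangle hvm _ _ _ (p + j + e j)).trans ?_⟩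
      gcongr
      refine PatchShift.ballDist_le hκ ha (he k (Finset.mem_sdiff.1 hk).1) (he j (hST hj)) ?_ hΩ hW
        hvm hv hWr
      have h1 := dist_triangle_left (p + k) (p + j) x
      rw [mem_ball] at hxj hxk
      linarith
  obtain ⟨c, hc⟩ := exists_lintegral_ball_enorm_sub_sq_le hΩ hW hvm hv hWr hρ0
    (he c₀ hc₀).ball_subset
  refine ⟨c, ?_⟩
  have hpatch : ∀ k ∈ T, ∫⁻ x in Ω ∩ ball (p + k) ρ, ‖v x - c‖ₑ ^ 2 ≤
      2 * (ENNReal.ofReal (16 / κ ^ 2) * E + 2 * (4 ^ n * (10 * (X * E)) + Q * E)) := by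
    intro k hk
    refine (lintegral_enorm_sub_sq_le (f₂ := fun x => v (x + e k)) hvm (by fun_prop)).trans ?_
    gcongr
    · exact (he k hk).setLIntegral_le hκ ha hΩ hW hv hWr
    calc ∫⁻ x in Ω ∩ ball (p + k) ρ, ‖v (x + e k) - c‖ₑ ^ 2
        ≤ ∫⁻ x in ball (0 : Euc N) ρ, ‖v (p + k + e k + x) - c‖ₑ ^ 2 := by
          have := setLIntegral_comp_add_right_le
            (F := fun x => ‖v (p + k + e k + x) - c‖ₑ ^ 2) (A := Ω ∩ ball (p + k) ρ)
            (S := ball (0 : Euc N) ρ) (e := -(p + k))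
            (hΩ.measurableSet.inter measurableSet_ball) measurableSet_ball ?_
          · convert this using 6 with y
            abel_nf
          · intro w hw
            rw [mem_ball_zero_iff, ← sub_eq_add_neg, ← dist_eq_norm]
            exact hw.2
      _ ≤ 2 * (ballDist v ρ (p + k + e k) (p + c₀ + e c₀) +
            ∫⁻ x in ball (0 : Euc N) ρ, ‖v (p + c₀ + e c₀ + x) - c‖ₑ ^ 2) :=
          lintegral_enorm_sub_sq_le (by fun_prop) (by fun_prop)
      _ ≤ _ := by
          gcongr
          rw [ballDist_comm]
          refine (hchain k hk).trans ?_
          gcongr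
          norm_num
  calc ∫⁻ x in Ω, ‖v x - c‖ₑ ^ 2 ≤ T.card * _ :=
        lintegral_le_card_mul T (fun k => Ω ∩ ball (p + k) ρ) (fun x hx => by
          obtain ⟨k, hk, hxk⟩ := hcov x hx
          exact mem_biUnion hk ⟨hx, hxk⟩) hpatch
    _ ≤ n * _ := by gcongr
    _ = _ := by ring

/-- A Hardy–Poincaré inequality on domains with the uniform interior cone condition, for weights
bounded below by the squared size of inscribed balls. -/
theorem exists_hardyPoincare (N : ℕ) {κ a : ℝ} (hκ : κ ∈ Ioc (0 : ℝ) 1) (ha : 0 < a) (d : ℝ) :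
    ∃ C : ENNReal, C ≠ ⊤ ∧ ∀ Ω : Set (Euc N), IsOpen Ω → IsConnected Ω →
      Bornology.IsBounded Ω → Metric.diam Ω ≤ d →
      (∀ x ∈ frontier Ω, ∃ ω, ConeDir κ a Ω x ω) →
      ∀ W v : Euc N → ℝ, ContinuousOn W Ω → ContDiffOn ℝ 1 v Ω →
      (∀ x r, 0 < r → ball x r ⊆ Ω → r ^ 2 / 2 ≤ W x) →
      ∃ c : ℝ, ∫⁻ x in Ω, ‖v x - c‖ₑ ^ 2 ≤ C * ∫⁻ x, energyDensity Ω W v x := by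
  obtain ⟨C, hC, h⟩ := exists_hardyPoincare_of_measurable N hκ ha d
  refine ⟨C, hC, fun Ω hΩ hconn hb hdiam hcone W v hW hv hWr => ?_⟩
  have heq : ∀ x ∈ Ω, Ω.indicator v x = v x := fun x hx => indicator_of_mem hx v
  obtain ⟨c, hc⟩ := h Ω hΩ hconn hb hdiam hcone W (Ω.indicator v) hW
    (measurable_indicator_of_continuousOn hΩ.measurableSet hv.continuousOn)
    (hv.congr heq) hWr
  refine ⟨c, ?_⟩
  have hE : energyDensity Ω W (Ω.indicator v) = energyDensity Ω W v := by
    refine indicator_congr fun x hx => ?_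
    have : Ω.indicator v =ᶠ[𝓝 x] v := by
      filter_upwards [hΩ.mem_nhds hx] with y hy using heq y hy
    rw [this.fderiv_eq]
  rw [hE] at hc
  refine le_of_eq_of_le ?_ hc
  exact setLIntegral_congr_fun hΩ.measurableSet fun x hx => by rw [heq x hx]

end HardyPoincare

section Mean

variable {α : Type*} [MeasurableSpace α] {μ : Measure α}

theorem integral_sub_average_sq_le [IsFiniteMeasure μ] {f : α → ℝ} (hf : MemLp f 2 μ) (c : ℝ) :
    ∫ x, (f x - ⨍ y, f y ∂μ) ^ 2 ∂μ ≤ ∫ x, (f x - c) ^ 2 ∂μ := by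
  set A := ⨍ y, f y ∂μ with hA
  have h1 : Integrable (fun x => (f x - A) ^ 2) μ := (hf.sub (memLp_const A)).integrable_sq
  have h2 : Integrable (fun x => f x - A) μ := (hf.integrable (by norm_num)).sub
    (integrable_const A)
  have h3 : ∫ x, (f x - c) ^ 2 ∂μ =
      ∫ x, (f x - A) ^ 2 ∂μ + (2 * (A - c) * ∫ x, (f x - A) ∂μ + ∫ _, (A - c) ^ 2 ∂μ) := by
    have h4 : Integrable (fun x => 2 * (A - c) * (f x - A) + (A - c) ^ 2) μ :=
      (h2.const_mul _).add (integrable_const _)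
    rw [← integral_const_mul, ← integral_add (h2.const_mul _) (integrable_const _),
      ← integral_add h1 h4]
    congr with x
    ring
  have h4 : 0 ≤ ∫ _ : α, (A - c) ^ 2 ∂μ := integral_nonneg fun _ => sq_nonneg _
  rw [h3, hA, integral_sub_average]
  linarith

theorem integral_le_toReal_lintegral_ofReal {f : α → ℝ} (hf : 0 ≤ f) :
    ∫ x, f x ∂μ ≤ (∫⁻ x, ENNReal.ofReal (f x) ∂μ).toReal := by
  have h := norm_integral_le_lintegral_norm (μ := μ) f
  simp only [Real.norm_of_nonneg (hf _)] at h
  exact (le_norm_self _).trans h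

end Mean

section Final

open Filter Topology

variable {N : ℕ} {Ω : Set (Euc N)} {W v : Euc N → ℝ}

theorem lintegral_energyDensity (hΩ : IsOpen Ω)
    (hW : ∀ x ∈ Ω, 0 ≤ W x) (hint : IntegrableOn (fun x => W x * ‖gradient v x‖ ^ 2) Ω) :
    ∫⁻ x, energyDensity Ω W v x = ENNReal.ofReal (∫ x in Ω, W x * ‖gradient v x‖ ^ 2) := by
  rw [ofReal_integral_eq_lintegral_ofReal hint ((ae_restrict_iff' hΩ.measurableSet).2
    (Eventually.of_forall fun x hx => mul_nonneg (hW x hx) (sq_nonneg _))), energyDensity,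
    lintegral_indicator hΩ.measurableSet]
  refine setLIntegral_congr_fun hΩ.measurableSet fun x hx => ?_
  have hnorm : ‖gradient v x‖ = ‖fderiv ℝ v x‖ := LinearIsometryEquiv.norm_map _ _
  simp only [hnorm]
  rw [ENNReal.ofReal_mul (hW x hx), ENNReal.ofReal_pow (norm_nonneg _), ofReal_norm]

/-- The integrated Hardy–Poincaré inequality gives control of the variance. -/
theorem ofReal_setIntegral_sub_average_sq_le {c : ℝ} (hfin : volume Ω ≠ ⊤)
    (hv : MemLp v 2 (volume.restrict Ω)) {B : ENNReal}
    (h : ∫⁻ x in Ω, ‖v x - c‖ₑ ^ 2 ≤ B) :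
    ENNReal.ofReal (∫ x in Ω, (v x - ⨍ y in Ω, v y) ^ 2) ≤ B := by
  have : IsFiniteMeasure (volume.restrict Ω) := isFiniteMeasure_restrict.2 hfin
  refine (ENNReal.ofReal_le_ofReal (integral_sub_average_sq_le hv c)).trans ?_
  have hint : Integrable (fun x => (v x - c) ^ 2) (volume.restrict Ω) :=
    (hv.sub (memLp_const c)).integrable_sq
  rw [ofReal_integral_eq_lintegral_ofReal hint (Eventually.of_forall fun x => sq_nonneg _)]
  refine le_of_eq_of_le (lintegral_congr fun x => ?_) h
  rw [← ofReal_norm, ← ENNReal.ofReal_pow (norm_nonneg _), Real.norm_eq_abs, sq_abs]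

end Final

/-- weighted trace inequality for `h - h_Ω`. -/
theorem stmt_8 (N : ℕ) (hN : 2 ≤ N) (θ a d m : ℝ) (hθ : θ ∈ Ioc (0:ℝ) (π / 2))
    (ha : 0 < a) (hd : 0 < d) (hm : 0 < m) :
    ∃ C > (0:ℝ), ∀ Ω : Set (Euc N), IsOpen Ω → IsConnected Ω → Bornology.IsBounded Ω →
      Metric.diam Ω ≤ d → UnifConeCond θ a Ω →
      ∀ u : Euc N → ℝ, IsTorsion Ω u →
      ∀ g : Euc N → Euc N, ContinuousOn g (closure Ω) → (∀ x ∈ Ω, g x = gradient u x) →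
      (∀ x ∈ frontier Ω, m ≤ ‖g x‖) →
      ∀ z : Euc N, z = (⨍ x in Ω, x) →
      ∀ h : Euc N → ℝ, h = (fun x => ‖x - z‖ ^ 2 / 2 - u x) →
      (∫ x in frontier Ω, (h x - ⨍ y in Ω, h y) ^ 2 ∂(μH[(N:ℝ) - 1])) ≤
        C * ∫ x in Ω, (-u x) * ‖gradient h x‖ ^ 2 := by
  have hN0 : 0 < N := by omega
  have hκ : Real.sin θ ∈ Ioc (0 : ℝ) 1 :=
    ⟨Real.sin_pos_of_pos_of_lt_pi hθ.1 (by linarith [hθ.2, Real.pi_pos]), Real.sin_le_one θ⟩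
  obtain ⟨CH, hCH, hardy⟩ := exists_hardyPoincare N hκ ha d
  set T := traceConst N (Real.sin θ) m
  have hT : T ≠ ⊤ := traceConst_ne_top _ _ _
  refine ⟨(T * (N * CH + 2)).toReal + 1, by positivity, ?_⟩
  intro Ω hΩ hconn hb hdiam hcone u hu g hg hgu hgm z _ h hh
  have hcone' : ∀ x ∈ frontier Ω, ∃ ω, ConeDir (Real.sin θ) a Ω x ω :=
    fun x hx => hcone.exists_coneDir hθ hx
  have hK : IsCompact (closure Ω) := hb.isCompact_closure
  have hfin : volume Ω ≠ ⊤ := hb.measure_lt_top.ne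
  have : IsFiniteMeasure (volume.restrict Ω) := isFiniteMeasure_restrict.2 hfin
  set A := ⨍ y in Ω, h y
  set v : Euc N → ℝ := fun x => h x - A with hvdef
  have hveq : v = fun x => 1 * (‖x - z‖ ^ 2 / 2) + (-1) * u x + (-A) := by
    rw [hvdef, hh]
    ext x
    ring
  have hvC : ContDiffOn ℝ 2 v Ω := fun x hx => by
    rw [hveq]
    exact (contDiffAt_quadratic_comb (hu.contDiffAt hΩ hx)).contDiffWithinAt
  have hlap : ∀ x ∈ Ω, lap v x = 0 := fun x hx => by
    rw [hveq, lap_quadratic_comb (hu.contDiffAt hΩ hx), hu.2.2.1 x hx]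
    ring
  have hgrad_vh : ∀ x, gradient v x = gradient h x := fun x => by
    simp only [gradient, hvdef, fderiv_sub_const]
  have hgradv : ∀ x ∈ Ω, gradient v x = (x - z) - g x := by
    intro x hx
    refine HasGradientAt.gradient (hasGradientAt_iff_hasFDerivAt.2 ?_)
    rw [hveq]
    refine (hasFDerivAt_quadratic_comb
      ((hu.contDiffAt hΩ hx).differentiableAt (by norm_num))).congr_fderiv ?_
    rw [hgu x hx]
    ext y
    simp [gradient, sub_eq_add_neg]
  have hhc : ContinuousOn h (closure Ω) := by
    rw [hh]
    exact (by fun_prop : Continuous fun x : Euc N => ‖x - z‖ ^ 2 / 2).continuousOn.sub hu.1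
  have hvc : ContinuousOn v (closure Ω) := hhc.sub continuousOn_const
  obtain ⟨M₁, hM₁⟩ := hK.exists_bound_of_continuousOn hg
  obtain ⟨M₂, hM₂⟩ := hK.exists_bound_of_continuousOn
    (f := fun x => (x - z) - g x) ((by fun_prop : Continuous fun x : Euc N => x - z).continuousOn.sub hg)
  obtain ⟨Mh, hMh⟩ := hK.exists_bound_of_continuousOn hhc
  obtain ⟨Mv, hMv⟩ := hK.exists_bound_of_continuousOn hvc
  obtain ⟨Mu, hMu⟩ := hK.exists_bound_of_continuousOn hu.1
  have htrace := hu.lintegral_frontier_sq_le hN0 hΩ hb hκ ha hm hcone' hg hgu hgm hvc hvC hlap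
    (M := max M₁ M₂)
    (fun x hx => by
      rw [← hgu x hx]
      exact (hM₁ x (subset_closure hx)).trans (le_max_left _ _))
    (fun x hx => by
      rw [hgradv x hx]
      exact (hM₂ x (subset_closure hx)).trans (le_max_right _ _))
  have hneg : ∀ x ∈ Ω, 0 ≤ -u x := fun x hx => by
    linarith [hu.nonpos hN0 hΩ hb (subset_closure hx)]
  have hintW : IntegrableOn (fun x => (-u x) * ‖gradient h x‖ ^ 2) Ω := by
    refine IntegrableOn.of_bound hfin.lt_top
      (ContinuousOn.aestronglyMeasurable ?_ hΩ.measurableSet) (Mu * M₂ ^ 2)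
      ((ae_restrict_iff' hΩ.measurableSet).2 (.of_forall fun x hx => ?_))
    · simp only [← hgrad_vh]
      exact hu.2.1.continuousOn.neg.mul ((continuousOn_gradient hΩ hvC).norm.pow 2)
    · rw [← hgrad_vh, hgradv x hx, norm_mul, norm_neg, norm_pow, norm_norm]
      have h1 := hMu x (subset_closure hx)
      have h2 := hM₂ x (subset_closure hx)
      have h3 := (norm_nonneg _).trans h1
      gcongr
  have hmem : MemLp h 2 (volume.restrict Ω) :=
    MemLp.of_bound ((hhc.mono subset_closure).aestronglyMeasurable hΩ.measurableSet) Mh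
      ((ae_restrict_iff' hΩ.measurableSet).2 (.of_forall fun x hx => hMh x (subset_closure hx)))
  have hintv : IntegrableOn (fun x => v x ^ 2) Ω := (hmem.sub (memLp_const A)).integrable_sq
  set I := ∫ x in Ω, (-u x) * ‖gradient h x‖ ^ 2 with hI
  have hI0 : 0 ≤ I := setIntegral_nonneg hΩ.measurableSet fun x hx =>
    mul_nonneg (hneg x hx) (sq_nonneg _)
  have hhC : ContDiffOn ℝ 1 h Ω := by
    have : h = fun x => v x + A := by simp [hvdef]
    rw [this]
    exact (hvC.of_le (by norm_num)).add contDiffOn_const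
  obtain ⟨c, hc⟩ := hardy Ω hΩ hconn hb hdiam hcone' (fun x => -u x) h hu.2.1.continuousOn.neg hhC
    fun x r hr hball => hu.le_of_ball_subset hN0 hΩ hb hr hball
  rw [lintegral_energyDensity hΩ hneg hintW] at hc
  have hvar := ofReal_setIntegral_sub_average_sq_le hfin hmem hc
  have hsplit : ∫ x in Ω, (N * v x ^ 2 + 2 * ((-u x) * ‖gradient v x‖ ^ 2)) =
      N * (∫ x in Ω, v x ^ 2) + 2 * I := by
    simp only [hgrad_vh]
    rw [integral_add (hintv.const_mul _) (hintW.const_mul _), integral_const_mul,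
      integral_const_mul]
  have hbound : ∫⁻ x in frontier Ω, ENNReal.ofReal (v x ^ 2) ∂μH[(N - 1 : ℕ)] ≤
      T * (N * CH + 2) * ENNReal.ofReal I := by
    refine htrace.trans ?_
    rw [hsplit, mul_assoc]
    refine mul_le_mul_right (ENNReal.ofReal_add_le.trans ?_) _
    rw [ENNReal.ofReal_mul (by positivity), ENNReal.ofReal_mul (by positivity),
      ENNReal.ofReal_natCast, ENNReal.ofReal_ofNat, add_mul, mul_assoc]
    gcongr
  have hdim : ((N - 1 : ℕ) : ℝ) = (N : ℝ) - 1 := by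
    rw [Nat.cast_sub (by omega), Nat.cast_one]
  rw [hdim] at hbound
  calc ∫ x in frontier Ω, v x ^ 2 ∂μH[(N : ℝ) - 1]
      ≤ (∫⁻ x in frontier Ω, ENNReal.ofReal (v x ^ 2) ∂μH[(N : ℝ) - 1]).toReal :=
        integral_le_toReal_lintegral_ofReal fun _ => sq_nonneg _
    _ ≤ (T * (N * CH + 2) * ENNReal.ofReal I).toReal :=
        ENNReal.toReal_mono (by finiteness) hbound
    _ = (T * (N * CH + 2)).toReal * I := by
        rw [ENNReal.toReal_mul, ENNReal.toReal_ofReal hI0]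
    _ ≤ ((T * (N * CH + 2)).toReal + 1) * I := by
        gcongr
        linarith
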